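/- arXiv:1703.02636 — 3 statements merged into one kernel-verified Lean document; each statement's English description precedes it below -/
import Mathlib

section
/- (Osgood-type blow-up criterion.) Let γ ∈ (0,1), let f be locally Lipschitz and non-decreasing on (0, ∞), let u₀ > 0 with f(u₀) > 0, and let T_b ∈ (0, ∞] be the maximal existence time of the solution of D_c^γ u = f(u), u(0) = u₀. Then T_b < ∞ if and only if there exists U > 0 such that ∫_U^∞ (u / f(u))^{1/γ} du/u < ∞. -/
open MeasureTheory Real Filter Set Asymptotics
open scoped ENNReal Topology

/-- `u` is a solution of the Volterra integral form of the fractional ODE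
`D_c^γ u = f(u)`, `u(0) = u₀`, on the interval `[0, T)` (with `T ∈ (0,∞]`),
taking values in the set `D`. -/
noncomputable def IsSolUpTo (γ : ℝ) (f : ℝ → ℝ) (D : Set ℝ) (u₀ : ℝ) (u : ℝ → ℝ)
    (T : ℝ≥0∞) : Prop :=
  u 0 = u₀ ∧
  ContinuousOn u {t : ℝ | 0 ≤ t ∧ ENNReal.ofReal t < T} ∧
  (∀ t : ℝ, 0 ≤ t → ENNReal.ofReal t < T → u t ∈ D) ∧
  (∀ t : ℝ, 0 ≤ t → ENNReal.ofReal t < T →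
    u t = u₀ + (1 / Real.Gamma γ) * ∫ s in (0:ℝ)..t, (t - s) ^ (γ - 1) * f (u s))

/-- The maximal existence time `T_b`: the supremum of all `T` such that a solution
exists on `[0, T)`. -/
noncomputable def maxTime (γ : ℝ) (f : ℝ → ℝ) (D : Set ℝ) (u₀ : ℝ) : ℝ≥0∞ :=
  sSup {T : ℝ≥0∞ | ∃ u : ℝ → ℝ, IsSolUpTo γ f D u₀ u T}


noncomputable def JJ (γ : ℝ) (h : ℝ → ℝ) (t : ℝ) : ℝ := ∫ s in (0:ℝ)..t, (t - s) ^ (γ - 1) * h s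

lemma kint {γ : ℝ} (hγ : 0 < γ) (a b t : ℝ) :
    IntervalIntegrable (fun s => (t - s) ^ (γ - 1)) volume a b := by
  have := (intervalIntegral.intervalIntegrable_rpow' (a := t - a) (b := t - b) (r := γ - 1) (by linarith)).comp_sub_left t
  simpa using this

lemma kval {γ : ℝ} (hγ : 0 < γ) (a t : ℝ) :
    ∫ s in a..t, (t - s) ^ (γ - 1) = (t - a) ^ γ / γ := by
  rw [intervalIntegral.integral_comp_sub_left (fun x => x ^ (γ - 1)) t, integral_rpow (Or.inl (by linarith))]
  simp [Real.zero_rpow hγ.ne']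

lemma khint {γ : ℝ} (hγ : 0 < γ) {h : ℝ → ℝ} {B : ℝ} (hm : Measurable h) (hB : ∀ s, |h s| ≤ B)
    (a b t : ℝ) : IntervalIntegrable (fun s => (t - s) ^ (γ - 1) * h s) volume a b := by
  rw [intervalIntegrable_iff]
  exact (intervalIntegrable_iff.1 (kint hγ a b t)).mul_bdd hm.aestronglyMeasurable
    (Filter.Eventually.of_forall fun s => by simpa using hB s)

lemma JJ_mono {γ : ℝ} (hγ : 0 < γ) {h h' : ℝ → ℝ} {B : ℝ} (hm : Measurable h) (hB : ∀ s, |h s| ≤ B)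
    (hm' : Measurable h') (hB' : ∀ s, |h' s| ≤ B) (hh : ∀ s, h s ≤ h' s) {t : ℝ} (ht : 0 ≤ t) :
    JJ γ h t ≤ JJ γ h' t := by
  refine intervalIntegral.integral_mono_on ht (khint hγ hm hB _ _ _) (khint hγ hm' hB' _ _ _) ?_
  intro s hs
  exact mul_le_mul_of_nonneg_left (hh s) (Real.rpow_nonneg (by linarith [hs.2]) _)

lemma JJ_nonneg {γ : ℝ} {h : ℝ → ℝ} (hh : ∀ s, 0 ≤ h s) {t : ℝ} (ht : 0 ≤ t) : 0 ≤ JJ γ h t := by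
  refine intervalIntegral.integral_nonneg ht ?_
  intro s hs
  exact mul_nonneg (Real.rpow_nonneg (by linarith [hs.2]) _) (hh s)

lemma JJ_upper {γ : ℝ} (hγ : 0 < γ) (hγ1 : γ < 1) {h : ℝ → ℝ} {B C : ℝ} (hm : Measurable h)
    (hB : ∀ s, |h s| ≤ B) (h0 : ∀ s, 0 ≤ h s) {s t : ℝ} (hs : 0 ≤ s) (hst : s ≤ t)
    (hC : ∀ r ∈ Ioo s t, h r ≤ C) : JJ γ h t ≤ JJ γ h s + C * ((t - s) ^ γ / γ) := by
  unfold JJ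
  rw [← intervalIntegral.integral_add_adjacent_intervals (khint hγ hm hB 0 s t) (khint hγ hm hB s t t)]
  refine add_le_add ?_ ?_
  · refine intervalIntegral.integral_mono_on_of_le_Ioo hs (khint hγ hm hB _ _ _) (khint hγ hm hB _ _ _) ?_
    intro r hr
    refine mul_le_mul_of_nonneg_right ?_ (h0 r)
    exact Real.rpow_le_rpow_of_nonpos (by linarith [hr.2]) (by linarith) (by linarith)
  · rw [← kval hγ, ← intervalIntegral.integral_const_mul]
    refine intervalIntegral.integral_mono_on_of_le_Ioo hst (khint hγ hm hB _ _ _) ((kint hγ _ _ _).const_mul _) ?_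
    intro r hr
    rw [mul_comm]
    exact mul_le_mul_of_nonneg_right (hC r hr) (Real.rpow_nonneg (by linarith [hr.2]) _)

lemma JJ_compl {γ : ℝ} (hγ : 0 < γ) {h : ℝ → ℝ} {B : ℝ} (hm : Measurable h)
    (hB : ∀ s, |h s| ≤ B) (t : ℝ) : JJ γ (fun s => B - h s) t = B * (t ^ γ / γ) - JJ γ h t := by
  unfold JJ
  have := kval hγ 0 t
  rw [sub_zero] at this
  rw [← this, ← intervalIntegral.integral_const_mul, ← intervalIntegral.integral_sub ((kint hγ _ _ _).const_mul _) (khint hγ hm hB _ _ _)]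
  congr 1; ext s; ring

lemma JJ_holder {γ : ℝ} (hγ : 0 < γ) (hγ1 : γ < 1) {h : ℝ → ℝ} {B : ℝ} (hm : Measurable h)
    (hB : ∀ s, |h s| ≤ B) (h0 : ∀ s, 0 ≤ h s) {s t : ℝ} (hs : 0 ≤ s) (hst : s ≤ t) :
    |JJ γ h t - JJ γ h s| ≤ B * ((t - s) ^ γ / γ) := by
  have hB0 : 0 ≤ B := (abs_nonneg _).trans (hB 0)
  have h1 := JJ_upper hγ hγ1 hm hB h0 hs hst (fun r _ => (le_abs_self _).trans (hB r))
  have h2 := JJ_upper (h := fun s => B - h s) (B := B) (C := B) hγ hγ1 (by fun_prop)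
    (fun r => by rw [abs_le]; constructor <;> linarith [h0 r, (le_abs_self _).trans (hB r)])
    (fun r => by linarith [(le_abs_self _).trans (hB r)]) hs hst (fun r _ => by linarith [h0 r])
  rw [JJ_compl hγ hm hB, JJ_compl hγ hm hB] at h2
  have h3 : B * (s ^ γ / γ) ≤ B * (t ^ γ / γ) := by
    have := Real.rpow_le_rpow hs hst hγ.le
    gcongr
  rw [abs_le]; constructor <;> linarith

lemma JJ_cont {γ : ℝ} (hγ : 0 < γ) (hγ1 : γ < 1) {h : ℝ → ℝ} {B : ℝ} (hm : Measurable h)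
    (hB : ∀ s, |h s| ≤ B) (h0 : ∀ s, 0 ≤ h s) : Continuous (fun t => JJ γ h (max t 0)) := by
  have key : ∀ s t : ℝ, |JJ γ h (max t 0) - JJ γ h (max s 0)| ≤ B * (|max t 0 - max s 0| ^ γ / γ) := by
    intro s t
    rcases le_total (max s 0) (max t 0) with hst | hst
    · rw [abs_of_nonneg (sub_nonneg.2 hst)]
      exact JJ_holder hγ hγ1 hm hB h0 (le_max_right _ _) hst
    · rw [abs_sub_comm, abs_sub_comm (max t 0), abs_of_nonneg (sub_nonneg.2 hst)]
      exact JJ_holder hγ hγ1 hm hB h0 (le_max_right _ _) hst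
  rw [continuous_iff_continuousAt]
  intro s
  rw [ContinuousAt, tendsto_iff_dist_tendsto_zero]
  refine squeeze_zero (g := fun t : ℝ => B * (|max t 0 - max s 0| ^ γ / γ)) (fun _ => dist_nonneg) (fun t => by rw [Real.dist_eq]; exact key s t) ?_
  have : Continuous fun t : ℝ => B * (|max t 0 - max s 0| ^ γ / γ) := by
    exact continuous_const.mul ((Continuous.rpow_const (by fun_prop) (fun _ => Or.inr hγ.le)).div_const _)
  have := this.tendsto s
  simpa [Real.zero_rpow hγ.ne'] using this

noncomputable def uit (γ : ℝ) (F : ℝ → ℝ) (u₀ : ℝ) : ℕ → ℝ → ℝ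
  | 0 => fun _ => u₀
  | n + 1 => fun t => u₀ + (1 / Real.Gamma γ) * JJ γ (fun s => F (uit γ F u₀ n s)) (max t 0)

lemma exists_global {γ : ℝ} (hγ : 0 < γ) (hγ1 : γ < 1) {F : ℝ → ℝ} {B : ℝ} (u₀ : ℝ)
    (hF : Continuous F) (hFm : Monotone F) (hB : ∀ s, |F s| ≤ B) (h0 : ∀ s, 0 ≤ F s) :
    ∃ u : ℝ → ℝ, Continuous u ∧ ∀ t, u t = u₀ + (1 / Real.Gamma γ) * JJ γ (fun s => F (u s)) (max t 0) := by
  have hG : 0 < 1 / Real.Gamma γ := one_div_pos.2 (Real.Gamma_pos_of_pos hγ)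
  have hc : ∀ n, Continuous (uit γ F u₀ n) := by
    intro n
    induction n with
    | zero => exact continuous_const
    | succ n ih =>
      exact continuous_const.add (continuous_const.mul
        (JJ_cont hγ hγ1 (h := fun s => F (uit γ F u₀ n s)) (hF.comp ih).measurable (fun s => hB _) (fun s => h0 _)))
  have hm : ∀ n t, uit γ F u₀ n t ≤ uit γ F u₀ (n+1) t := by
    intro n
    induction n with
    | zero =>
      intro t
      simp only [uit]
      have := mul_nonneg hG.le (JJ_nonneg (γ := γ) (h := fun s => F u₀) (fun s => h0 _) (le_max_right t 0))
      linarith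
    | succ n ih =>
      intro t
      rw [uit, uit]
      have := JJ_mono (h := fun s => F (uit γ F u₀ n s)) (h' := fun s => F (uit γ F u₀ (n+1) s)) hγ (hF.comp (hc n)).measurable (fun s => hB _) (hF.comp (hc (n+1))).measurable (fun s => hB _)
        (fun s => hFm (ih s)) (le_max_right t 0)
      have := mul_le_mul_of_nonneg_left this hG.le
      linarith
  have hbd : ∀ t n, uit γ F u₀ n t ≤ u₀ + (1 / Real.Gamma γ) * JJ γ (fun _ => B) (max t 0) := by
    intro t n
    have hB0 : 0 ≤ B := (abs_nonneg _).trans (hB 0)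
    cases n with
    | zero =>
      have := mul_nonneg hG.le (JJ_nonneg (γ := γ) (h := fun s => B) (fun s => hB0) (le_max_right t 0))
      simp only [uit]; linarith
    | succ n =>
      rw [uit]
      have := JJ_mono (h := fun s => F (uit γ F u₀ n s)) (h' := fun s => B) hγ (hF.comp (hc n)).measurable (fun s => hB _) measurable_const (fun s => (abs_of_nonneg hB0).le)
        (fun s => (le_abs_self _).trans (hB _)) (le_max_right t 0)
      have := mul_le_mul_of_nonneg_left this hG.le
      linarith
  let u : ℝ → ℝ := fun t => ⨆ n, uit γ F u₀ n t
  have hlim : ∀ t, Tendsto (fun n => uit γ F u₀ n t) atTop (𝓝 (u t)) := fun t =>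
    tendsto_atTop_ciSup (monotone_nat_of_le_succ (fun n => hm n t)) ⟨_, by rintro _ ⟨n, rfl⟩; exact hbd t n⟩
  have hum : Measurable u := measurable_of_tendsto_metrizable (fun n => (hc n).measurable) (tendsto_pi_nhds.2 hlim)
  have heq : ∀ t, u t = u₀ + (1 / Real.Gamma γ) * JJ γ (fun s => F (u s)) (max t 0) := by
    intro t
    have h1 : Tendsto (fun n => JJ γ (fun s => F (uit γ F u₀ n s)) (max t 0)) atTop (𝓝 (JJ γ (fun s => F (u s)) (max t 0))) := by
      unfold JJ
      refine intervalIntegral.tendsto_integral_filter_of_dominated_convergence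
        (fun s => |(max t 0 - s) ^ (γ - 1)| * B) ?_ ?_ ?_ ?_
      · exact Eventually.of_forall fun n => by
          have := (khint (h := fun s => F (uit γ F u₀ n s)) hγ (hF.comp (hc n)).measurable (fun s => hB _) 0 (max t 0) (max t 0))
          exact (intervalIntegrable_iff.1 this).aestronglyMeasurable
      · refine Eventually.of_forall fun n => Eventually.of_forall fun s _ => ?_
        rw [norm_mul, Real.norm_eq_abs, Real.norm_eq_abs]
        exact mul_le_mul_of_nonneg_left (hB _) (abs_nonneg _)
      · exact (kint hγ _ _ _).abs.mul_const _
      · refine Eventually.of_forall fun s _ => ?_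
        exact ((hF.tendsto _).comp (hlim s)).const_mul _
    have h2 := (h1.const_mul (1 / Real.Gamma γ)).const_add u₀
    exact tendsto_nhds_unique ((tendsto_add_atTop_iff_nat 1).2 (hlim t)) h2
  refine ⟨u, ?_, heq⟩
  have : u = fun t => u₀ + (1 / Real.Gamma γ) * JJ γ (fun s => F (u s)) (max t 0) := funext heq
  rw [this]
  exact continuous_const.add (continuous_const.mul
        (JJ_cont hγ hγ1 (h := fun s => F (u s)) (hF.measurable.comp hum) (fun s => hB _) (fun s => h0 _)))

/-- crossing time lower bound -/
lemma crossing {γ : ℝ} (hγ : 0 < γ) (hγ1 : γ < 1) {F f : ℝ → ℝ} {B : ℝ} {u₀ : ℝ} (hu₀ : 0 < u₀)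
    (hF : Continuous F) (hFm : Monotone F) (hB : ∀ s, |F s| ≤ B) (h0 : ∀ s, 0 ≤ F s)
    (hFf : ∀ n : ℕ, F (u₀ * 2 ^ n) ≤ f (u₀ * 2 ^ n)) (hfp : ∀ n : ℕ, 0 < f (u₀ * 2 ^ n))
    {u : ℝ → ℝ} (hu : Continuous u)
    (hsol : ∀ t, u t = u₀ + (1 / Real.Gamma γ) * JJ γ (fun s => F (u s)) (max t 0)) (n : ℕ) :
    ∀ t, 0 ≤ t → u₀ * 2 ^ n ≤ u t →
      ∑ k ∈ Finset.range n, (Real.Gamma γ * γ * (u₀ * 2 ^ k) / f (u₀ * 2 ^ (k+1))) ^ (1/γ) ≤ t := by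
  have hG : 0 < Real.Gamma γ := Real.Gamma_pos_of_pos hγ
  have hu0 : u 0 = u₀ := by rw [hsol]; simp [JJ]
  induction n with
  | zero => intro t ht _; simpa using ht
  | succ n ih =>
    intro t ht htu
    set c := u₀ * 2 ^ (n+1) with hc
    have hcomp : IsCompact (Icc 0 t ∩ u ⁻¹' Ici c) := isCompact_Icc.inter_right (isClosed_Ici.preimage hu)
    obtain ⟨τ, ⟨hτ, hτu⟩, hτl⟩ := hcomp.exists_isLeast ⟨t, ⟨ht, le_rfl⟩, htu⟩
    have hτu : c ≤ u τ := hτu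
    have hlt : ∀ r, 0 ≤ r → r < τ → u r ≤ c := by
      intro r hr hrτ
      by_contra hcon
      push Not at hcon
      have := hτl ⟨⟨hr, hrτ.le.trans hτ.2⟩, hcon.le⟩
      linarith
    have hcn : c = u₀ * 2 ^ n + u₀ * 2 ^ n := by rw [hc]; ring
    have hpn : 0 < u₀ * 2 ^ n := by positivity
    have h1n : u₀ ≤ u₀ * 2 ^ n := le_mul_of_one_le_right hu₀.le (one_le_pow₀ (by norm_num))
    obtain ⟨σ, hσ, hσu⟩ := intermediate_value_Icc hτ.1 hu.continuousOn
      (show u₀ * 2 ^ n ∈ Icc (u 0) (u τ) from ⟨by rw [hu0]; exact h1n, by linarith⟩)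
    have h1 := ih σ hσ.1 hσu.ge
    have h2 := JJ_upper (h := fun s => F (u s)) (C := f c) hγ hγ1 (hF.comp hu).measurable (fun s => hB _) (fun s => h0 _) hσ.1 hσ.2
      (fun r hr => (hFm (hlt r (hσ.1.trans hr.1.le) hr.2)).trans (hFf (n+1)))
    have e1 := hsol σ
    have e2 := hsol τ
    rw [max_eq_left hσ.1] at e1
    rw [max_eq_left hτ.1] at e2
    have hfc : 0 < f c := hfp (n+1)
    have h3 : u₀ * 2 ^ n ≤ (1 / Real.Gamma γ) * (f c * ((τ - σ) ^ γ / γ)) := by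
      have := mul_le_mul_of_nonneg_left h2 (one_div_pos.2 hG).le
      linarith
    have h4 : Real.Gamma γ * γ * (u₀ * 2 ^ n) / f c ≤ (τ - σ) ^ γ := by
      rw [div_le_iff₀ hfc]
      have := mul_le_mul_of_nonneg_left h3 (mul_pos hG hγ).le
      calc _ ≤ _ := this
        _ = _ := by field_simp
    have h5 : (Real.Gamma γ * γ * (u₀ * 2 ^ n) / f c) ^ (1/γ) ≤ τ - σ := by
      have h6 := Real.rpow_le_rpow (by positivity) h4 (one_div_pos.2 hγ).le
      rwa [← Real.rpow_mul (by linarith [hσ.2]), mul_one_div_cancel hγ.ne', Real.rpow_one] at h6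
    rw [Finset.sum_range_succ]
    linarith [hτ.2]

lemma f_cont {f : ℝ → ℝ}
    (hf : ∀ x ∈ Set.Ioi (0:ℝ), ∃ K : NNReal, ∃ s ∈ 𝓝[Set.Ioi (0:ℝ)] x, LipschitzOnWith K f s) :
    ContinuousOn f (Ioi 0) := by
  intro x hx
  obtain ⟨K, s, hs, hL⟩ := hf x hx
  have hxs : x ∈ s := mem_of_mem_nhdsWithin hx hs
  exact (hL.continuousOn x hxs).mono_of_mem_nhdsWithin hs

lemma sol_ge {γ u₀ : ℝ} {f : ℝ → ℝ} (hγ : 0 < γ) (hfc : ContinuousOn f (Ioi 0))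
    (hmono : MonotoneOn f (Set.Ioi 0)) (hu₀ : 0 < u₀) (hfu₀ : 0 < f u₀) {u : ℝ → ℝ} {T : ℝ≥0∞}
    (hu : IsSolUpTo γ f (Ioi 0) u₀ u T) : ∀ t, 0 ≤ t → ENNReal.ofReal t < T → u₀ ≤ u t := by
  obtain ⟨hu0, hcont, hD, heq⟩ := hu
  have hG : 0 < 1 / Real.Gamma γ := one_div_pos.2 (Real.Gamma_pos_of_pos hγ)
  have step : ∀ t, 0 ≤ t → ENNReal.ofReal t < T → (∀ s ∈ Ioo 0 t, 0 ≤ f (u s)) → u₀ ≤ u t := by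
    intro t ht htT h
    rw [heq t ht htT, intervalIntegral.integral_of_le ht, integral_Ioc_eq_integral_Ioo]
    have : 0 ≤ ∫ s in Ioo 0 t, (t - s) ^ (γ - 1) * f (u s) := by
      refine setIntegral_nonneg measurableSet_Ioo ?_
      intro s hs
      exact mul_nonneg (Real.rpow_nonneg (by linarith [hs.2]) _) (h s hs)
    have := mul_nonneg hG.le this
    linarith
  obtain ⟨v, hv0, hvu, hfv⟩ : ∃ v, 0 < v ∧ v < u₀ ∧ 0 < f v := by
    have h1 : ∀ᶠ v in 𝓝 u₀, 0 < f v := (hfc.continuousAt (Ioi_mem_nhds hu₀)).eventually (lt_mem_nhds hfu₀)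
    have h2 : ∀ᶠ v in 𝓝[<] u₀, 0 < f v ∧ 0 < v :=
      nhdsWithin_le_nhds (h1.and (lt_mem_nhds hu₀))
    obtain ⟨v, ⟨hv1, hv2⟩, hv3⟩ := (h2.and self_mem_nhdsWithin).exists
    exact ⟨v, hv2, hv3, hv1⟩
  have hgt : ∀ t, 0 ≤ t → ENNReal.ofReal t < T → v < u t := by
    intro t ht htT
    by_contra hcon
    push Not at hcon
    have hsub : Icc 0 t ⊆ {t : ℝ | 0 ≤ t ∧ ENNReal.ofReal t < T} :=
      fun s hs => ⟨hs.1, (ENNReal.ofReal_le_ofReal hs.2).trans_lt htT⟩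
    have hcl : IsCompact (Icc 0 t ∩ u ⁻¹' Iic v) :=
      isCompact_Icc.of_isClosed_subset ((hcont.mono hsub).preimage_isClosed_of_isClosed isClosed_Icc isClosed_Iic) inter_subset_left
    obtain ⟨τ, ⟨hτ, hτu⟩, hτl⟩ := hcl.exists_isLeast ⟨t, ⟨ht, le_rfl⟩, hcon⟩
    have hτu : u τ ≤ v := hτu
    have := step τ hτ.1 (hsub hτ).2 (by
      intro s hs
      have hvs : v < u s := by
        by_contra hc
        push Not at hc
        have := hτl ⟨⟨hs.1.le, hs.2.le.trans hτ.2⟩, hc⟩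
        linarith [hs.2]
      exact hfv.le.trans (hmono hv0 (hv0.trans hvs) hvs.le))
    linarith
  intro t ht htT
  refine step t ht htT fun s hs => ?_
  have hvs := hgt s hs.1.le ((ENNReal.ofReal_le_ofReal hs.2.le).trans_lt htT)
  exact hfv.le.trans (hmono hv0 (hv0.trans hvs) hvs.le)

noncomputable def ee (γ u₀ : ℝ) (f : ℝ → ℝ) (n : ℕ) : ℝ := (u₀ * 2 ^ (n+1) / f (u₀ * 2 ^ n)) ^ (1/γ)

lemma blowup {γ u₀ : ℝ} {f : ℝ → ℝ} (hγ : 0 < γ) (hfc : ContinuousOn f (Ioi 0))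
    (hmono : MonotoneOn f (Set.Ioi 0)) (hu₀ : 0 < u₀) (hfu₀ : 0 < f u₀)
    (hfp : ∀ n : ℕ, 0 < f (u₀ * 2 ^ n))
    (hs : Summable (ee γ u₀ f)) : maxTime γ f (Ioi 0) u₀ < ⊤ := by
  have hG : 0 < Real.Gamma γ := Real.Gamma_pos_of_pos hγ
  set C := (Real.Gamma γ * γ) ^ (1/γ) with hC
  have hC0 : 0 < C := by positivity
  have he0 : ∀ n, 0 ≤ ee γ u₀ f n := fun n => by
    have := hfp n
    unfold ee; positivity
  refine lt_of_le_of_lt ?_ (ENNReal.ofReal_lt_top (r := ∑' n, C * ee γ u₀ f n))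
  refine sSup_le ?_
  rintro T ⟨u, hu⟩
  by_contra hT
  push Not at hT
  have hge := sol_ge hγ hfc hmono hu₀ hfu₀ hu
  obtain ⟨hu0, hcont, hD, heq⟩ := hu
  have key : ∀ n : ℕ, ∀ t, 0 ≤ t → ENNReal.ofReal t < T → ∑ k ∈ Finset.range n, C * ee γ u₀ f k ≤ t → u₀ * 2 ^ n ≤ u t := by
    intro n
    induction n with
    | zero => intro t ht htT _; simpa using hge t ht htT
    | succ n ih =>
      intro t ht htT hsum
      rw [Finset.sum_range_succ] at hsum
      set a := ∑ k ∈ Finset.range n, C * ee γ u₀ f k with ha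
      have ha0 : 0 ≤ a := Finset.sum_nonneg fun k _ => mul_nonneg hC0.le (he0 k)
      have hat : a ≤ t := by linarith [mul_nonneg hC0.le (he0 n)]
      have hsub : Icc 0 t ⊆ {t : ℝ | 0 ≤ t ∧ ENNReal.ofReal t < T} :=
        fun s hs => ⟨hs.1, (ENNReal.ofReal_le_ofReal hs.2).trans_lt htT⟩
      have hfu : ContinuousOn (fun s => f (u s)) (Icc 0 t) :=
        hfc.comp (hcont.mono hsub) (fun s hs => hD s (hsub hs).1 (hsub hs).2)
      have hint : IntervalIntegrable (fun s => (t - s) ^ (γ - 1) * f (u s)) volume 0 t :=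
        (kint hγ 0 t t).mul_continuousOn (by rwa [uIcc_of_le ht])
      have hi1 : IntervalIntegrable (fun s => (t - s) ^ (γ - 1) * f (u s)) volume 0 a :=
        hint.mono_set (by rw [uIcc_of_le ht, uIcc_of_le ha0]; exact Icc_subset_Icc_right hat)
      have hi2 : IntervalIntegrable (fun s => (t - s) ^ (γ - 1) * f (u s)) volume a t :=
        hint.mono_set (by rw [uIcc_of_le ht, uIcc_of_le hat]; exact Icc_subset_Icc_left ha0)
      have h1 : 0 ≤ ∫ s in (0:ℝ)..a, (t - s) ^ (γ - 1) * f (u s) := by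
        refine intervalIntegral.integral_nonneg ha0 fun s hs => ?_
        have := hge s hs.1 (hsub ⟨hs.1, hs.2.trans hat⟩).2
        exact mul_nonneg (Real.rpow_nonneg (by linarith [hs.2]) _)
          (hfu₀.le.trans (hmono hu₀ (hu₀.trans_le this) this))
      have h2 : f (u₀ * 2 ^ n) * ((t - a) ^ γ / γ) ≤ ∫ s in a..t, (t - s) ^ (γ - 1) * f (u s) := by
        rw [← kval hγ, ← intervalIntegral.integral_const_mul]
        refine intervalIntegral.integral_mono_on hat ((kint hγ _ _ _).const_mul _) hi2 ?_
        intro s hs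
        rw [mul_comm]
        have hp : 0 < u₀ * 2 ^ n := by positivity
        have := ih s (ha0.trans hs.1) (hsub ⟨ha0.trans hs.1, hs.2⟩).2 hs.1
        exact mul_le_mul_of_nonneg_left (hmono hp (hp.trans_le this) this) (Real.rpow_nonneg (by linarith [hs.2]) _)
      have h3 := intervalIntegral.integral_add_adjacent_intervals hi1 hi2
      have h4 : Real.Gamma γ * γ * (u₀ * 2 ^ (n+1) / f (u₀ * 2 ^ n)) ≤ (t - a) ^ γ := by
        have h5 : C * ee γ u₀ f n ≤ t - a := by linarith
        have h6 := Real.rpow_le_rpow (mul_nonneg hC0.le (he0 n)) h5 hγ.le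
        have hpos : 0 ≤ u₀ * 2 ^ (n+1) / f (u₀ * 2 ^ n) := by
          have := hfp n
          positivity
        rwa [hC, ee, ← Real.mul_rpow (by positivity) hpos, ← Real.rpow_mul (by positivity), one_div_mul_cancel hγ.ne', Real.rpow_one] at h6
      rw [heq t ht htT, ← h3]
      have h7 : u₀ * 2 ^ (n+1) ≤ 1 / Real.Gamma γ * (f (u₀ * 2 ^ n) * ((t - a) ^ γ / γ)) := by
        have hfn := hfp n
        have : u₀ * 2 ^ (n+1) = 1 / Real.Gamma γ * (f (u₀ * 2 ^ n) * (Real.Gamma γ * γ * (u₀ * 2 ^ (n+1) / f (u₀ * 2 ^ n)) / γ)) := by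
          field_simp
        rw [this]
        gcongr
      have h8 := mul_le_mul_of_nonneg_left (add_le_add h1 h2) (one_div_pos.2 hG).le
      linarith
  set S := ∑' n, C * ee γ u₀ f n with hS
  have hsC : Summable fun n => C * ee γ u₀ f n := hs.mul_left C
  have hnn : ∀ n, 0 ≤ C * ee γ u₀ f n := fun n => mul_nonneg hC0.le (he0 n)
  have h1 : ∀ n : ℕ, u₀ * 2 ^ n ≤ u S := fun n =>
    key n S (tsum_nonneg hnn) hT (hsC.sum_le_tsum _ (fun k _ => hnn k))
  obtain ⟨n, hn⟩ := pow_unbounded_of_one_lt (u S / u₀) (one_lt_two)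
  rw [div_lt_iff₀ hu₀] at hn
  linarith [h1 n]

lemma global_sum {γ u₀ : ℝ} {f : ℝ → ℝ} (hγ : 0 < γ) (hγ1 : γ < 1) (hfc : ContinuousOn f (Ioi 0))
    (hmono : MonotoneOn f (Set.Ioi 0)) (hu₀ : 0 < u₀) (hfu₀ : 0 < f u₀)
    (hfp : ∀ n : ℕ, 0 < f (u₀ * 2 ^ n))
    (hT : maxTime γ f (Ioi 0) u₀ < ⊤) : Summable (ee γ u₀ f) := by
  have hG : 0 < Real.Gamma γ := Real.Gamma_pos_of_pos hγ
  obtain ⟨T, hT1, hT2⟩ := ENNReal.lt_iff_exists_nnreal_btwn.1 hT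
  have main : ∀ N : ℕ, ∑ k ∈ Finset.range N, (Real.Gamma γ * γ * (u₀ * 2 ^ k) / f (u₀ * 2 ^ (k+1))) ^ (1/γ) ≤ T := by
    intro N
    set M := u₀ * 2 ^ N with hM
    have hone : ∀ n : ℕ, u₀ ≤ u₀ * 2 ^ n := fun n => le_mul_of_one_le_right hu₀.le (one_le_pow₀ (by norm_num))
    let F : ℝ → ℝ := fun x => f (max u₀ (min x M))
    have hmem : ∀ x, max u₀ (min x M) ∈ Ioi (0:ℝ) := fun x => hu₀.trans_le (le_max_left _ _)
    have hMpos : M ∈ Ioi (0:ℝ) := hu₀.trans_le (hone N)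
    have hF : Continuous F := hfc.comp_continuous (by fun_prop) hmem
    have hFm : Monotone F := fun x y hxy => hmono (hmem x) (hmem y) (by gcongr)
    have h0 : ∀ s, 0 ≤ F s := fun s => hfu₀.le.trans (hmono hu₀ (hmem s) (le_max_left _ _))
    have hB : ∀ s, |F s| ≤ f M := fun s => by
      rw [abs_of_nonneg (h0 s)]
      exact hmono (hmem s) hMpos (max_le (hone N) (min_le_right _ _))
    have hFf : ∀ n : ℕ, F (u₀ * 2 ^ n) ≤ f (u₀ * 2 ^ n) := fun n =>
      hmono (hmem _) (hu₀.trans_le (hone n)) (max_le (hone n) (min_le_left _ _))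
    obtain ⟨u, hu, hsol⟩ := exists_global hγ hγ1 u₀ hF hFm hB h0
    have hcr := crossing hγ hγ1 hu₀ hF hFm hB h0 hFf hfp hu hsol N
    by_contra hcon
    push Not at hcon
    have hlt : ∀ t : ℝ, 0 ≤ t → t < T → u t < M := by
      intro t ht htT
      by_contra hc
      push Not at hc
      have := hcr t ht hc
      linarith
    have hge : ∀ t, u₀ ≤ u t := by
      intro t
      rw [hsol]
      have := mul_nonneg (one_div_pos.2 hG).le (JJ_nonneg (γ := γ) (h := fun s => F (u s)) (fun s => h0 _) (le_max_right t 0))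
      linarith
    have hsolT : IsSolUpTo γ f (Ioi 0) u₀ u (T : ℝ≥0∞) := by
      have hTt : ∀ t : ℝ, 0 ≤ t → ENNReal.ofReal t < T → t < T := by
        intro t ht h
        rw [← ENNReal.ofReal_coe_nnreal] at h
        exact (ENNReal.ofReal_lt_ofReal_iff_of_nonneg ht).1 h
      refine ⟨by rw [hsol]; simp [JJ], hu.continuousOn, fun t _ _ => hu₀.trans_le (hge t), ?_⟩
      intro t ht htT
      conv_lhs => rw [hsol t, max_eq_left ht]
      unfold JJ
      congr 2
      refine intervalIntegral.integral_congr fun s hs => ?_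
      rw [uIcc_of_le ht] at hs
      have h1 := (hlt s hs.1 (hs.2.trans_lt (hTt t ht htT))).le
      simp only [F]
      rw [min_eq_left h1, max_eq_right (hge s)]
    have : (T : ℝ≥0∞) ≤ maxTime γ f (Ioi 0) u₀ := le_sSup ⟨u, hsolT⟩
    exact absurd hT1 (not_lt.2 this)
  have hsum := summable_of_sum_range_le (fun n => Real.rpow_nonneg (by
    have := hfp (n+1)
    positivity) _) main
  rw [← summable_nat_add_iff 1]
  have := hsum.mul_left ((4 / (Real.Gamma γ * γ)) ^ (1/γ))
  refine this.congr fun n => ?_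
  have hfn := hfp (n+1)
  rw [ee, ← Real.mul_rpow (by positivity) (by positivity)]
  congr 1
  field_simp
  ring

lemma integ_iff {γ u₀ : ℝ} {f : ℝ → ℝ} (hγ : 0 < γ) (hfc : ContinuousOn f (Ioi 0))
    (hmono : MonotoneOn f (Set.Ioi 0)) (hu₀ : 0 < u₀) (hfu₀ : 0 < f u₀)
    (hfp : ∀ n : ℕ, 0 < f (u₀ * 2 ^ n)) :
    Summable (ee γ u₀ f) ↔ ∃ U : ℝ, 0 < U ∧
        IntegrableOn (fun x : ℝ => (x / f x) ^ (1 / γ) / x) (Set.Ioi U) := by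
  set G : ℝ → ℝ := fun x => (x / f x) ^ (1 / γ) / x with hGdef
  set p : ℕ → ℝ := fun n => u₀ * 2 ^ n with hp
  have hpp : ∀ n, 0 < p n := fun n => by simp only [hp]; positivity
  have hps : ∀ n, p (n+1) = 2 * p n := fun n => by simp only [hp]; ring
  have hp0 : p 0 = u₀ := by simp [hp]
  have hpm : Monotone p := monotone_nat_of_le_succ fun n => by rw [hps]; linarith [hpp n]
  have hpt : Tendsto p atTop atTop :=
    (tendsto_pow_atTop_atTop_of_one_lt (one_lt_two (α := ℝ))).const_mul_atTop hu₀
  have hfpos : ∀ x, u₀ ≤ x → 0 < f x := fun x hx => hfu₀.trans_le (hmono hu₀ (hu₀.trans_le hx) hx)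
  have hGc : ContinuousOn G (Ici u₀) := by
    have hid : ContinuousOn (fun x : ℝ => x) (Ici u₀) := continuousOn_id
    have hf' : ContinuousOn f (Ici u₀) := hfc.mono fun x hx => hu₀.trans_le hx
    exact ((hid.div hf' fun x hx => (hfpos x hx).ne').rpow_const (fun x hx => Or.inr (by positivity))).div hid
      fun x hx => (hu₀.trans_le hx).ne'
  have hG0 : ∀ x, u₀ ≤ x → 0 ≤ G x := fun x hx => by
    have h1 := hfpos x hx
    have h2 := hu₀.trans_le hx
    simp only [hGdef]; positivity
  have hGi : ∀ a b, u₀ ≤ a → a ≤ b → IntervalIntegrable G volume a b := fun a b ha hab =>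
    (hGc.mono (by rw [uIcc_of_le hab]; exact fun x hx => ha.trans hx.1)).intervalIntegrable
  have hup : ∀ n : ℕ, u₀ ≤ p n := fun n => hp0 ▸ hpm (Nat.zero_le n)
  have hcz : 0 < 1 / γ := by positivity
  have hupper : ∀ n, ∫ x in (p n)..(p (n+1)), G x ≤ ee γ u₀ f n := by
    intro n
    have hle : p n ≤ p (n+1) := hpm (Nat.le_succ n)
    have h1 : ∫ x in (p n)..(p (n+1)), G x ≤ ∫ x in (p n)..(p (n+1)), ee γ u₀ f n / p n := by
      refine intervalIntegral.integral_mono_on hle (hGi _ _ (hup n) hle) intervalIntegrable_const ?_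
      intro x hx
      have hx0 := (hup n).trans hx.1
      have h2 := hfpos x hx0
      have h3 := hu₀.trans_le hx0
      have h4 : 0 < f (p n) := hfp n
      have h5 : f (p n) ≤ f x := hmono (hpp n) h3 hx.1
      have h6 := hpp n
      have h7 := hpp (n+1)
      have e : ee γ u₀ f n = (p (n+1) / f (p n)) ^ (1/γ) := rfl
      rw [e]
      simp only [hGdef]
      have := hx.1
      have := hx.2
      gcongr
    refine h1.trans (le_of_eq ?_)
    rw [intervalIntegral.integral_const, hps, smul_eq_mul]
    have := hpp n
    field_simp
    ring
  have hlower : ∀ n, (1/4 : ℝ) ^ (1/γ) / 2 * ee γ u₀ f (n+1) ≤ ∫ x in (p n)..(p (n+1)), G x := by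
    intro n
    have hle : p n ≤ p (n+1) := hpm (Nat.le_succ n)
    have h1 : ∫ x in (p n)..(p (n+1)), (p n / f (p (n+1))) ^ (1/γ) / p (n+1) ≤ ∫ x in (p n)..(p (n+1)), G x := by
      refine intervalIntegral.integral_mono_on hle intervalIntegrable_const (hGi _ _ (hup n) hle) ?_
      intro x hx
      have hx0 := (hup n).trans hx.1
      have h2 := hfpos x hx0
      have h3 := hu₀.trans_le hx0
      have h4 : 0 < f (p (n+1)) := hfp (n+1)
      have h5 : f x ≤ f (p (n+1)) := hmono h3 (hpp (n+1)) hx.2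
      have h6 := hpp n
      have h7 := hpp (n+1)
      simp only [hGdef]
      have := hx.1
      have := hx.2
      gcongr
    refine le_trans (le_of_eq ?_) h1
    have h4 : 0 < f (p (n+1)) := hfp (n+1)
    have h6 := hpp n
    have h7 := hpp (n+1)
    have h8 := hpp (n+2)
    have e : ee γ u₀ f (n+1) = (p (n+2) / f (p (n+1))) ^ (1/γ) := rfl
    have e2 : p n / f (p (n+1)) = 1/4 * (p (n+2) / f (p (n+1))) := by
      rw [hps (n+1), hps n]; ring
    rw [intervalIntegral.integral_const, smul_eq_mul, e, e2, Real.mul_rpow (by norm_num) (by positivity), hps n]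
    field_simp
    ring
  have hsumint : ∀ N, ∑ k ∈ Finset.range N, ∫ x in (p k)..(p (k+1)), G x = ∫ x in u₀..(p N), G x := by
    intro N
    rw [← hp0]
    exact intervalIntegral.sum_integral_adjacent_intervals fun k _ => hGi _ _ (hup k) (hpm (Nat.le_succ k))
  have he0 : ∀ n, 0 ≤ ee γ u₀ f n := fun n => by
    have := hfp n
    unfold ee; positivity
  constructor
  · intro hs
    refine ⟨u₀, hu₀, ?_⟩
    refine integrableOn_Ioi_of_intervalIntegral_norm_bounded (∑' n, ee γ u₀ f n) u₀ (l := atTop) (b := p) (fun n => ?_) hpt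
      (Eventually.of_forall fun N => ?_)
    · exact (intervalIntegrable_iff_integrableOn_Ioc_of_le (hup n)).1 (hGi _ _ le_rfl (hup n))
    · have : ∫ x in u₀..(p N), ‖G x‖ = ∫ x in u₀..(p N), G x := by
        refine intervalIntegral.integral_congr fun x hx => ?_
        rw [uIcc_of_le (hup N)] at hx
        exact Real.norm_of_nonneg (hG0 x hx.1)
      rw [this, ← hsumint]
      exact (Finset.sum_le_sum fun k _ => hupper k).trans (hs.sum_le_tsum _ fun k _ => he0 k)
  · rintro ⟨U, hU, hint⟩
    have hint' : IntegrableOn G (Ioi u₀) := by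
      have h1 : IntegrableOn G (Ioc u₀ (max u₀ U)) :=
        (intervalIntegrable_iff_integrableOn_Ioc_of_le (le_max_left _ _)).1 (hGi _ _ le_rfl (le_max_left _ _))
      have h2 := h1.union (hint.mono_set (Ioi_subset_Ioi (le_max_right u₀ U)))
      rwa [Ioc_union_Ioi_eq_Ioi (le_max_left _ _)] at h2
    have hs : Summable fun n => (1/4 : ℝ) ^ (1/γ) / 2 * ee γ u₀ f (n+1) := by
      refine summable_of_sum_range_le (c := ∫ x in Ioi u₀, G x) (fun n => mul_nonneg (by positivity) (he0 _)) fun N => ?_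
      refine (Finset.sum_le_sum fun k _ => hlower k).trans ?_
      rw [hsumint, intervalIntegral.integral_of_le (hup N)]
      refine setIntegral_mono_set hint' ?_ (Eventually.of_forall Ioc_subset_Ioi_self)
      exact (ae_restrict_mem measurableSet_Ioi).mono fun x hx => hG0 x (le_of_lt hx)
    rw [summable_mul_left_iff (by positivity)] at hs
    exact (summable_nat_add_iff 1).1 hs

/-- Osgood-type blow-up criterion. -/
theorem stmt7 (γ u₀ : ℝ) (f : ℝ → ℝ)
    (hγ : γ ∈ Set.Ioo (0:ℝ) 1)
    (hf : ∀ x ∈ Set.Ioi (0:ℝ), ∃ K : NNReal, ∃ s ∈ 𝓝[Set.Ioi (0:ℝ)] x, LipschitzOnWith K f s)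
    (hmono : MonotoneOn f (Set.Ioi 0))
    (hu₀ : 0 < u₀) (hfu₀ : 0 < f u₀) :
    maxTime γ f (Set.Ioi 0) u₀ < ⊤ ↔
      ∃ U : ℝ, 0 < U ∧
        IntegrableOn (fun x : ℝ => (x / f x) ^ (1 / γ) / x) (Set.Ioi U) := by
  have hfc := f_cont hf
  have hfp : ∀ n : ℕ, 0 < f (u₀ * 2 ^ n) := fun n => by
    have h : u₀ ≤ u₀ * 2 ^ n := le_mul_of_one_le_right hu₀.le (one_le_pow₀ (by norm_num))
    exact hfu₀.trans_le (hmono hu₀ (hu₀.trans_le h) h)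
  rw [← integ_iff hγ.1 hfc hmono hu₀ hfu₀ hfp]
  exact ⟨global_sum hγ.1 hγ.2 hfc hmono hu₀ hfu₀ hfp, blowup hγ.1 hfc hmono hu₀ hfu₀ hfp⟩
end

section
/- Let γ ∈ (0,1), p ≥ 0, A > 0, u₀ > 0, and let u be the unique solution of D_c^γ u = A u^p, u(0) = u₀, on its maximal interval [0, T_b). Then: (1) u is increasing on (0, T_b) and lim_{t→T_b⁻} u(t) = ∞; (2) solution curves with distinct nonnegative initial values do not intersect; (3) if 0 ≤ p ≤ 1 then T_b = ∞, i.e. the solution exists globally; (4) if p > 1 then T_b < ∞, i.e. the solution blows up in finite time. -/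
open MeasureTheory Real Filter Set Asymptotics
open scoped ENNReal Topology

section helpers

variable {γ : ℝ}

lemma kern_int (hγ : 0 < γ) (t a b : ℝ) :
    IntervalIntegrable (fun s => (t - s) ^ (γ - 1)) volume a b := by
  have h := (intervalIntegral.intervalIntegrable_rpow' (r := γ - 1) (by linarith)
    (a := t - a) (b := t - b)).comp_sub_left t
  simpa using h

lemma kern_mul_int (hγ : 0 < γ) (t a b : ℝ) {φ : ℝ → ℝ} (hφ : ContinuousOn φ (uIcc a b)) :
    IntervalIntegrable (fun s => (t - s) ^ (γ - 1) * φ s) volume a b :=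
  (kern_int hγ t a b).mul_continuousOn hφ

lemma kern_val (hγ : 0 < γ) {a t : ℝ} :
    ∫ s in a..t, (t - s) ^ (γ - 1) = (t - a) ^ γ / γ := by
  rw [intervalIntegral.integral_comp_sub_left (fun x => x ^ (γ - 1)) t]
  rw [integral_rpow (Or.inl (by linarith))]
  simp [hγ.ne']

lemma kern_exp_le (hγ : 0 < γ) {l : ℝ} (hl : 0 < l) {t : ℝ} (ht : 0 ≤ t) :
    ∫ s in (0:ℝ)..t, (t - s) ^ (γ - 1) * Real.exp (-(l * (t - s))) ≤ l ^ (-γ) * Real.Gamma γ := by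
  rw [intervalIntegral.integral_comp_sub_left (fun x => x ^ (γ - 1) * Real.exp (-(l * x))) t]
  have h := Real.integral_rpow_mul_exp_neg_mul_Ioi hγ hl
  have hG := Real.Gamma_pos_of_pos hγ
  have hl' : (1 / l) ^ γ = l ^ (-γ) := by
    rw [one_div, Real.inv_rpow hl.le, Real.rpow_neg hl.le]
  have hint : IntegrableOn (fun x : ℝ => x ^ (γ - 1) * Real.exp (-(l * x))) (Ioi 0) := by
    by_contra hc
    have := integral_undef hc
    rw [this] at h
    have : 0 < (1 / l) ^ γ * Real.Gamma γ := by positivity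
    linarith
  rw [← hl', ← h]
  rw [sub_self, sub_zero, intervalIntegral.integral_of_le ht]
  apply setIntegral_mono_set hint
  · filter_upwards [ae_restrict_mem measurableSet_Ioi] with x hx
    have : (0:ℝ) < x := hx
    simp only [Pi.zero_apply]
    positivity
  · exact (Ioc_subset_Ioi_self).eventuallyLE

lemma volt_bound (hγ : 0 < γ) {l : ℝ} (hl : 0 < l) {t : ℝ} (ht : 0 ≤ t) {φ : ℝ → ℝ} {B : ℝ}
    (hB : 0 ≤ B) (hφ : ∀ s ∈ Icc 0 t, |φ s| ≤ B * Real.exp (l * s)) :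
    |(1 / Real.Gamma γ) * ∫ s in (0:ℝ)..t, (t - s) ^ (γ - 1) * φ s|
      ≤ B * Real.exp (l * t) * l ^ (-γ) := by
  have hG := Real.Gamma_pos_of_pos hγ
  have h1 : ‖∫ s in (0:ℝ)..t, (t - s) ^ (γ - 1) * φ s‖ ≤
      ∫ s in (0:ℝ)..t, B * Real.exp (l * t) * ((t - s) ^ (γ - 1) * Real.exp (-(l * (t - s)))) := by
    apply intervalIntegral.norm_integral_le_of_norm_le ht
    · refine Eventually.of_forall fun s hs => ?_
      have hts : 0 ≤ t - s := by linarith [hs.2]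
      have hk : 0 ≤ (t - s) ^ (γ - 1) := by positivity
      rw [norm_mul, Real.norm_eq_abs, Real.norm_eq_abs, abs_of_nonneg hk]
      have := mul_le_mul_of_nonneg_left (hφ s ⟨hs.1.le, hs.2⟩) hk
      refine this.trans (le_of_eq ?_)
      have : Real.exp (l * s) = Real.exp (l * t) * Real.exp (-(l * (t - s))) := by
        rw [← Real.exp_add]; ring_nf
      rw [this]; ring
    · apply IntervalIntegrable.const_mul
      apply kern_mul_int hγ
      fun_prop
  rw [intervalIntegral.integral_const_mul] at h1
  have h2 := kern_exp_le hγ hl ht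
  have h3 : 0 ≤ B * Real.exp (l * t) := by positivity
  rw [abs_mul, abs_of_nonneg (by positivity : 0 ≤ 1 / Real.Gamma γ)]
  rw [Real.norm_eq_abs] at h1
  calc _ ≤ 1 / Real.Gamma γ * (B * Real.exp (l * t) * (l ^ (-γ) * Real.Gamma γ)) := by
        gcongr
        exact h1.trans (by gcongr)
    _ = _ := by field_simp

lemma volt_cont (hγ : 0 < γ) {φ : ℝ → ℝ} (hφ : Continuous φ) :
    Continuous (fun t : ℝ => ∫ s in (0:ℝ)..(max t 0), (max t 0 - s) ^ (γ - 1) * φ s) := by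
  have key : ∀ t : ℝ, 0 ≤ t → ∫ s in (0:ℝ)..t, (t - s) ^ (γ - 1) * φ s
      = t ^ γ * ∫ x in (0:ℝ)..1, (1 - x) ^ (γ - 1) * φ (t * x) := by
    intro t ht
    rcases ht.eq_or_lt with rfl | ht
    · simp [Real.zero_rpow hγ.ne']
    have h := intervalIntegral.mul_integral_comp_mul_left (a := 0) (b := 1) (c := t)
      (f := fun s => (t - s) ^ (γ - 1) * φ s)
    rw [mul_zero, mul_one] at h
    rw [← h, ← intervalIntegral.integral_const_mul, ← intervalIntegral.integral_const_mul]
    apply intervalIntegral.integral_congr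
    intro x hx
    rw [uIcc_of_le zero_le_one] at hx
    simp only
    have : t - t * x = t * (1 - x) := by ring
    rw [this, Real.mul_rpow ht.le (by linarith [hx.2]), Real.rpow_sub_one ht.ne']
    field_simp
  have hc : Continuous (fun t : ℝ => ∫ x in (0:ℝ)..1, (1 - x) ^ (γ - 1) * φ (t * x)) := by
    rw [continuous_iff_continuousAt]
    intro t₀
    obtain ⟨C, hC⟩ := (isCompact_Icc (a := -(|t₀| + 1)) (b := |t₀| + 1)).exists_bound_of_continuousOn
      hφ.continuousOn
    apply intervalIntegral.continuousAt_of_dominated_interval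
      (bound := fun x => (1 - x) ^ (γ - 1) * C)
    · refine Eventually.of_forall fun t => ?_
      have := kern_mul_int hγ 1 0 1 (φ := fun x => φ (t * x)) (by fun_prop)
      rw [uIoc_of_le zero_le_one]
      exact this.1.aestronglyMeasurable
    · filter_upwards [Metric.ball_mem_nhds t₀ one_pos] with t ht
      refine Eventually.of_forall fun x hx => ?_
      rw [uIoc_of_le zero_le_one] at hx
      have hk : 0 ≤ (1 - x) ^ (γ - 1) := Real.rpow_nonneg (by linarith [hx.2]) _
      rw [norm_mul, Real.norm_eq_abs, abs_of_nonneg hk]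
      gcongr
      apply hC
      rw [mem_Icc, ← abs_le]
      rw [Metric.mem_ball, Real.dist_eq] at ht
      have h1 : |t| ≤ |t₀| + 1 := by
        have := abs_sub_abs_le_abs_sub t t₀
        linarith
      rw [abs_mul, abs_of_pos hx.1]
      nlinarith [abs_nonneg t, hx.2]
    · exact (kern_int hγ 1 0 1).mul_const C
    · refine Eventually.of_forall fun x _ => ?_
      fun_prop
  have : (fun t : ℝ => ∫ s in (0:ℝ)..(max t 0), (max t 0 - s) ^ (γ - 1) * φ s) =
      fun t => (max t 0) ^ γ * ∫ x in (0:ℝ)..1, (1 - x) ^ (γ - 1) * φ (max t 0 * x) := by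
    funext t
    exact key _ (le_max_right _ _)
  rw [this]
  have hm : Continuous (fun t : ℝ => max t 0) := by fun_prop
  exact (hm.rpow_const (fun _ => Or.inr hγ.le)).mul (hc.comp hm)

/-- comparison principle -/
lemma volt_cmp (hγ : 0 < γ) {f : ℝ → ℝ} (hfc : Continuous f) (hf : MonotoneOn f (Ici 0))
    {a b α β : ℝ → ℝ} {T : ℝ} (ha : ContinuousOn a (Icc 0 T)) (hb : ContinuousOn b (Icc 0 T))
    (ha0 : ∀ t ∈ Icc 0 T, 0 ≤ a t) (hb0 : ∀ t ∈ Icc 0 T, 0 ≤ b t)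
    (hav : ∀ t ∈ Icc 0 T, a t = α t + (1 / Real.Gamma γ) *
      ∫ s in (0:ℝ)..t, (t - s) ^ (γ - 1) * f (a s))
    (hbv : ∀ t ∈ Icc 0 T, b t = β t + (1 / Real.Gamma γ) *
      ∫ s in (0:ℝ)..t, (t - s) ^ (γ - 1) * f (b s))
    (hαβ : ∀ t ∈ Icc 0 T, α t < β t) : ∀ t ∈ Icc 0 T, a t < b t := by
  by_contra! hcon
  obtain ⟨t₂, ht₂, h2⟩ := hcon
  have hcl : IsClosed {t ∈ Icc 0 T | b t ≤ a t} := isClosed_Icc.isClosed_le hb ha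
  have hcp : IsCompact {t ∈ Icc 0 T | b t ≤ a t} :=
    isCompact_Icc.of_isClosed_subset hcl (fun x hx => hx.1)
  obtain ⟨t, ⟨htT, htle⟩, hmin⟩ := hcp.exists_isLeast ⟨t₂, ht₂, h2⟩
  have hlt : ∀ s ∈ Ioo 0 t, a s < b s := by
    intro s hs
    by_contra! hc
    have := hmin (a := s) ⟨⟨hs.1.le, hs.2.le.trans htT.2⟩, hc⟩
    linarith [hs.2]
  have hsub : uIcc 0 t ⊆ Icc 0 T := by
    rw [uIcc_of_le htT.1]; exact Icc_subset_Icc_right htT.2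
  have hI : ∫ s in (0:ℝ)..t, (t - s) ^ (γ - 1) * f (a s) ≤
      ∫ s in (0:ℝ)..t, (t - s) ^ (γ - 1) * f (b s) := by
    apply intervalIntegral.integral_mono_on_of_le_Ioo htT.1
    · exact kern_mul_int hγ _ _ _ (hfc.comp_continuousOn (ha.mono hsub))
    · exact kern_mul_int hγ _ _ _ (hfc.comp_continuousOn (hb.mono hsub))
    · intro s hs
      have hs' : s ∈ Icc 0 T := ⟨hs.1.le, hs.2.le.trans htT.2⟩
      have hk : 0 ≤ (t - s) ^ (γ - 1) := Real.rpow_nonneg (by linarith [hs.2]) _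
      exact mul_le_mul_of_nonneg_left (hf (ha0 s hs') (hb0 s hs') (hlt s hs).le) hk
  have hG := Real.Gamma_pos_of_pos hγ
  have hI2 := mul_le_mul_of_nonneg_left hI (by positivity : 0 ≤ 1 / Real.Gamma γ)
  have := hαβ t htT
  rw [hav t htT, hbv t htT] at htle
  linarith

lemma exists_weight (hγ : 0 < γ) {K : ℝ} (hK : 0 ≤ K) : ∃ l : ℝ, 0 < l ∧ K * l ^ (-γ) ≤ 1 / 2 := by
  refine ⟨(2 * K + 1) ^ (1 / γ), by positivity, ?_⟩
  rw [← Real.rpow_mul (by positivity)]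
  have : 1 / γ * -γ = -1 := by field_simp
  rw [this, Real.rpow_neg_one, ← div_eq_mul_inv, div_le_div_iff₀ (by positivity) (by positivity)]
  linarith

/-- uniqueness for Lipschitz nonlinearities -/
lemma volt_unique (hγ : 0 < γ) {f : ℝ → ℝ} {K : NNReal} (hf : LipschitzWith K f)
    {a b : ℝ → ℝ} {T u₀ : ℝ} (ha : ContinuousOn a (Icc 0 T)) (hb : ContinuousOn b (Icc 0 T))
    (hav : ∀ t ∈ Icc 0 T, a t = u₀ + (1 / Real.Gamma γ) *
      ∫ s in (0:ℝ)..t, (t - s) ^ (γ - 1) * f (a s))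
    (hbv : ∀ t ∈ Icc 0 T, b t = u₀ + (1 / Real.Gamma γ) *
      ∫ s in (0:ℝ)..t, (t - s) ^ (γ - 1) * f (b s)) : ∀ t ∈ Icc 0 T, a t = b t := by
  obtain ⟨l, hl, hKl⟩ := exists_weight hγ K.2
  change (K:ℝ) * _ ≤ _ at hKl
  intro t₀ ht₀
  have hT : (0:ℝ) ≤ T := ht₀.1.trans ht₀.2
  obtain ⟨t, ht, hmax⟩ := (isCompact_Icc (a := (0:ℝ)) (b := T)).exists_isMaxOn
    (f := fun s => Real.exp (-(l * s)) * |a s - b s|) ⟨t₀, ht₀⟩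
    (by fun_prop)
  set W := Real.exp (-(l * t)) * |a t - b t| with hW
  have hW0 : 0 ≤ W := by positivity
  have hbd : ∀ s ∈ Icc 0 T, |a s - b s| ≤ W * Real.exp (l * s) := by
    intro s hs
    have h1 : Real.exp (-(l * s)) * |a s - b s| ≤ W := hmax hs
    rw [Real.exp_neg, inv_mul_le_iff₀ (Real.exp_pos _)] at h1
    linarith
  have hsub : uIcc 0 t ⊆ Icc 0 T := by
    rw [uIcc_of_le ht.1]; exact Icc_subset_Icc_right ht.2
  have hdiff : a t - b t = (1 / Real.Gamma γ) *
      ∫ s in (0:ℝ)..t, (t - s) ^ (γ - 1) * (f (a s) - f (b s)) := by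
    rw [hav t ht, hbv t ht]
    simp only [mul_sub]
    rw [intervalIntegral.integral_sub]
    · ring
    · exact kern_mul_int hγ _ _ _ (hf.continuous.comp_continuousOn (ha.mono hsub))
    · exact kern_mul_int hγ _ _ _ (hf.continuous.comp_continuousOn (hb.mono hsub))
  have h2 := volt_bound hγ hl ht.1 (φ := fun s => f (a s) - f (b s)) (B := K * W) (by positivity)
    (by
      intro s hs
      have h3 := hf.dist_le_mul (a s) (b s)
      rw [Real.dist_eq, Real.dist_eq] at h3
      have h4 := hbd s ⟨hs.1, hs.2.trans ht.2⟩
      calc _ ≤ _ := h3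
        _ ≤ K * (W * Real.exp (l * s)) := by gcongr
        _ = _ := by ring)
  rw [← hdiff] at h2
  have h5 : |a t - b t| = W * Real.exp (l * t) := by
    rw [hW, Real.exp_neg]; field_simp
  rw [h5] at h2
  have h6 : W * Real.exp (l * t) ≤ W * Real.exp (l * t) * (1 / 2) := by
    calc _ ≤ _ := h2
      _ = W * Real.exp (l * t) * (K * l ^ (-γ)) := by ring
      _ ≤ _ := by gcongr
  have h7 : W = 0 := by
    have := Real.exp_pos (l * t)
    nlinarith
  have h8 := hbd t₀ ht₀
  rw [h7, zero_mul] at h8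
  have := abs_nonpos_iff.mp h8
  linarith

/-- global existence for Lipschitz nonlinearities -/
lemma volt_exists (hγ : 0 < γ) {f : ℝ → ℝ} {K : NNReal} (hf : LipschitzWith K f) (u₀ : ℝ) :
    ∃ u : ℝ → ℝ, Continuous u ∧ ∀ t, 0 ≤ t → u t = u₀ + (1 / Real.Gamma γ) *
      ∫ s in (0:ℝ)..t, (t - s) ^ (γ - 1) * f (u s) := by
  obtain ⟨l, hl, hKl⟩ := exists_weight hγ K.2
  change (K:ℝ) * _ ≤ _ at hKl
  have hlγ : 0 < l ^ (-γ) := by positivity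
  have hfc := hf.continuous
  -- growth
  have hgr : ∀ x, |f x| ≤ |f 0| + K * |x| := by
    intro x
    have h3 := hf.dist_le_mul x 0
    rw [Real.dist_eq, Real.dist_eq, sub_zero] at h3
    have := abs_sub_abs_le_abs_sub (f x) (f 0)
    linarith
  let J : (BoundedContinuousFunction ℝ ℝ) → ℝ → ℝ := fun w t =>
    (1 / Real.Gamma γ) * ∫ s in (0:ℝ)..t, (t - s) ^ (γ - 1) * f (Real.exp (l * s) * w s)
  have hJ : ∀ w t, J w t = (1 / Real.Gamma γ) * ∫ s in (0:ℝ)..t,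
    (t - s) ^ (γ - 1) * f (Real.exp (l * s) * w s) := fun _ _ => rfl
  have hJb : ∀ (w : BoundedContinuousFunction ℝ ℝ) t, 0 ≤ t →
      |J w t| ≤ (|f 0| + K * ‖w‖) * Real.exp (l * t) * l ^ (-γ) := by
    intro w t ht
    apply volt_bound hγ hl ht (by positivity)
    intro s hs
    have h1 : 1 ≤ Real.exp (l * s) := Real.one_le_exp (mul_nonneg hl.le hs.1)
    have h2 := w.norm_coe_le_norm s
    rw [Real.norm_eq_abs] at h2
    calc _ ≤ _ := hgr _
      _ = |f 0| * 1 + K * (Real.exp (l * s) * |w s|) := by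
        rw [abs_mul, abs_of_pos (Real.exp_pos _), mul_one]
      _ ≤ |f 0| * Real.exp (l * s) + K * (Real.exp (l * s) * ‖w‖) := by gcongr
      _ = _ := by ring
  have hJd : ∀ (w z : BoundedContinuousFunction ℝ ℝ) t, 0 ≤ t →
      |J w t - J z t| ≤ (K * dist w z) * Real.exp (l * t) * l ^ (-γ) := by
    intro w z t ht
    have : J w t - J z t = (1 / Real.Gamma γ) * ∫ s in (0:ℝ)..t, (t - s) ^ (γ - 1) *
        (f (Real.exp (l * s) * w s) - f (Real.exp (l * s) * z s)) := by
      rw [hJ, hJ]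
      simp only [mul_sub]
      rw [intervalIntegral.integral_sub]
      · ring
      · exact kern_mul_int hγ _ _ _ (by fun_prop)
      · exact kern_mul_int hγ _ _ _ (by fun_prop)
    rw [this]
    apply volt_bound hγ hl ht (by positivity)
    intro s hs
    have h3 := hf.dist_le_mul (Real.exp (l * s) * w s) (Real.exp (l * s) * z s)
    rw [Real.dist_eq, Real.dist_eq, ← mul_sub, abs_mul, abs_of_pos (Real.exp_pos _),
      ← Real.dist_eq (w s)] at h3
    have h4 := BoundedContinuousFunction.dist_coe_le_dist (f := w) (g := z) s
    calc _ ≤ _ := h3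
      _ ≤ K * (Real.exp (l * s) * dist w z) := by gcongr
      _ = _ := by ring
  have hcontr : ∀ t B : ℝ, Real.exp (-(l * t)) * (B * Real.exp (l * t) * l ^ (-γ))
      = B * l ^ (-γ) := by
    intro t B
    rw [Real.exp_neg]; field_simp
  let Φ : BoundedContinuousFunction ℝ ℝ → BoundedContinuousFunction ℝ ℝ := fun w =>
    BoundedContinuousFunction.ofNormedAddCommGroup
      (fun t => Real.exp (-(l * max t 0)) * (u₀ + J w (max t 0)))
      (by
        have : Continuous (fun t => J w (max t 0)) := by
          have := volt_cont hγ (φ := fun s => f (Real.exp (l * s) * w s)) (by fun_prop)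
          exact continuous_const.mul this
        exact (by fun_prop : Continuous fun t : ℝ => Real.exp (-(l * max t 0))).mul
          (continuous_const.add this))
      (|u₀| + (|f 0| + K * ‖w‖) * l ^ (-γ))
      (by
        intro t
        have h0 : (0:ℝ) ≤ max t 0 := le_max_right _ _
        have h1 : Real.exp (-(l * max t 0)) ≤ 1 := Real.exp_le_one_iff.mpr (by
          have := mul_nonneg hl.le h0
          linarith)
        rw [Real.norm_eq_abs, abs_mul, abs_of_pos (Real.exp_pos _)]
        calc _ ≤ Real.exp (-(l * max t 0)) * (|u₀| + |J w (max t 0)|) := by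
              gcongr; exact abs_add_le _ _
          _ ≤ Real.exp (-(l * max t 0)) * |u₀| + Real.exp (-(l * max t 0)) *
              ((|f 0| + K * ‖w‖) * Real.exp (l * max t 0) * l ^ (-γ)) := by
              rw [mul_add]; gcongr; exact hJb w _ h0
          _ ≤ _ := by
              rw [hcontr]
              have := mul_le_mul_of_nonneg_right h1 (abs_nonneg u₀)
              linarith)
  have hΦ : ∀ w t, Φ w t = Real.exp (-(l * max t 0)) * (u₀ + J w (max t 0)) := fun _ _ => rfl
  have hcw : ContractingWith (1/2 : NNReal) Φ := by
    refine ⟨by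
      rw [← NNReal.coe_lt_coe]; norm_num, LipschitzWith.of_dist_le_mul fun w z => ?_⟩
    rw [BoundedContinuousFunction.dist_le (by positivity)]
    intro t
    have h0 : (0:ℝ) ≤ max t 0 := le_max_right _ _
    rw [hΦ, hΦ, Real.dist_eq, ← mul_sub, abs_mul, abs_of_pos (Real.exp_pos _),
      add_sub_add_left_eq_sub]
    calc _ ≤ Real.exp (-(l * max t 0)) * ((K * dist w z) * Real.exp (l * max t 0) * l ^ (-γ)) := by
          gcongr; exact hJd w z _ h0
      _ = (K * l ^ (-γ)) * dist w z := by rw [hcontr]; ring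
      _ ≤ 1 / 2 * dist w z := by gcongr
      _ = _ := by norm_num
  obtain ⟨w, hw⟩ : ∃ w, Φ w = w := ⟨_, hcw.fixedPoint_isFixedPt⟩
  refine ⟨fun t => Real.exp (l * t) * w t, by fun_prop, fun t ht => ?_⟩
  have h := hΦ w t
  rw [hw, max_eq_left ht] at h
  simp only
  rw [h, ← mul_assoc, ← Real.exp_add, add_neg_cancel, Real.exp_zero, one_mul]

end helpers

section main

variable {γ : ℝ}

lemma volt_nonneg (hγ : 0 < γ) {t : ℝ} (ht : 0 ≤ t) {φ : ℝ → ℝ} (hφ : ∀ s ∈ Icc 0 t, 0 ≤ φ s) :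
    0 ≤ (1 / Real.Gamma γ) * ∫ s in (0:ℝ)..t, (t - s) ^ (γ - 1) * φ s := by
  have hG := Real.Gamma_pos_of_pos hγ
  apply mul_nonneg (by positivity)
  apply intervalIntegral.integral_nonneg ht
  intro s hs
  exact mul_nonneg (Real.rpow_nonneg (by linarith [hs.2]) _) (hφ s hs)

lemma dom_sub {T : ℝ≥0∞} {t : ℝ} (ht : ENNReal.ofReal t < T) :
    Icc 0 t ⊆ {t : ℝ | 0 ≤ t ∧ ENNReal.ofReal t < T} := fun _ hs =>
  ⟨hs.1, (ENNReal.ofReal_le_ofReal hs.2).trans_lt ht⟩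

lemma sol_strictMono (hγ : 0 < γ) {f : ℝ → ℝ} (hfc : Continuous f) (hf : MonotoneOn f (Ici 0))
    (hpos : ∀ x, 0 < x → 0 < f x) {u₀ : ℝ} {u : ℝ → ℝ} {T : ℝ≥0∞}
    (hu : IsSolUpTo γ f (Ioi 0) u₀ u T) :
    StrictMonoOn u {t : ℝ | 0 ≤ t ∧ ENNReal.ofReal t < T} := by
  obtain ⟨-, hc, hD, hv⟩ := hu
  intro x hx y hy hxy
  have hsub := dom_sub hy.2
  have hG := Real.Gamma_pos_of_pos hγ
  set h := y - x with hh
  have hh0 : 0 < h := by linarith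
  have hcy : ContinuousOn u (Icc 0 y) := hc.mono hsub
  have hshift : ∀ t ∈ Icc 0 x, t + h ∈ Icc 0 y := fun t ht =>
    ⟨by linarith [ht.1], by linarith [ht.2]⟩
  have hxy' : Icc 0 x ⊆ Icc 0 y := Icc_subset_Icc_right hxy.le
  have := volt_cmp hγ hfc hf (a := u) (b := fun s => u (s + h)) (T := x) (α := fun _ => u₀)
    (β := fun t => u₀ + (1 / Real.Gamma γ) * ∫ s in (0:ℝ)..h, (t + h - s) ^ (γ - 1) * f (u s))
    (hcy.mono hxy')
    (hcy.comp (by fun_prop) hshift)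
    (fun t ht => le_of_lt (hD t (hsub (hxy' ht)).1 (hsub (hxy' ht)).2))
    (fun t ht => le_of_lt (hD _ (hsub (hshift t ht)).1 (hsub (hshift t ht)).2))
    (fun t ht => hv t (hsub (hxy' ht)).1 (hsub (hxy' ht)).2)
    (by
      intro t ht
      have h1 := hv _ (hsub (hshift t ht)).1 (hsub (hshift t ht)).2
      rw [h1]
      have hint : ∀ a ∈ Icc 0 y, ∀ b ∈ Icc 0 y, IntervalIntegrable
          (fun s => (t + h - s) ^ (γ - 1) * f (u s)) volume a b := by
        intro a ha b hb
        apply kern_mul_int hγ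
        exact hfc.comp_continuousOn (hcy.mono (uIcc_subset_Icc ha hb))
      have hy0 : (0:ℝ) ∈ Icc 0 y := ⟨le_rfl, hy.1⟩
      have hyh : h ∈ Icc 0 y := ⟨hh0.le, by linarith [hx.1]⟩
      rw [← intervalIntegral.integral_add_adjacent_intervals (hint 0 hy0 h hyh)
        (hint h hyh (t + h) (hshift t ht))]
      have h2 := intervalIntegral.integral_comp_add_right (a := 0) (b := t)
        (fun s => (t + h - s) ^ (γ - 1) * f (u s)) h
      rw [zero_add] at h2
      rw [← h2]
      simp only [add_sub_add_right_eq_sub]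
      ring)
    (by
      intro t ht
      have : 0 < ∫ s in (0:ℝ)..h, (t + h - s) ^ (γ - 1) * f (u s) := by
        have hyh : h ∈ Icc 0 y := ⟨hh0.le, by linarith [hx.1]⟩
        apply intervalIntegral.intervalIntegral_pos_of_pos_on _ _ hh0
        · apply kern_mul_int hγ
          exact hfc.comp_continuousOn (hcy.mono (uIcc_subset_Icc ⟨le_rfl, hy.1⟩ hyh))
        · intro s hs
          have hs' := hsub (a := s) ⟨hs.1.le, hs.2.le.trans hyh.2⟩
          exact mul_pos (Real.rpow_pos_of_pos (by linarith [hs.2, ht.1]) _)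
            (hpos _ (hD s hs'.1 hs'.2))
      have : 0 < (1 / Real.Gamma γ) * ∫ s in (0:ℝ)..h, (t + h - s) ^ (γ - 1) * f (u s) := by
        positivity
      linarith)
    x ⟨hx.1, le_rfl⟩
  simpa [hh] using this

lemma sol_lower (hγ : 0 < γ) {f : ℝ → ℝ} (hfc : Continuous f) (hf : MonotoneOn f (Ici 0))
    (hpos : ∀ x, 0 < x → 0 < f x) {u₀ : ℝ} {u : ℝ → ℝ} {T : ℝ≥0∞}
    (hu : IsSolUpTo γ f (Ioi 0) u₀ u T) {a t : ℝ} (ha : 0 ≤ a) (hat : a ≤ t)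
    (ht : ENNReal.ofReal t < T) :
    u₀ + (1 / Real.Gamma γ) * (f (u a) * ((t - a) ^ γ / γ)) ≤ u t := by
  have hmono := (sol_strictMono hγ hfc hf hpos hu).monotoneOn
  obtain ⟨-, hc, hD, hv⟩ := hu
  have hsub := dom_sub ht
  have hG := Real.Gamma_pos_of_pos hγ
  have hct : ContinuousOn u (Icc 0 t) := hc.mono hsub
  rw [hv t (ha.trans hat) ht]
  have hat' : a ∈ Icc 0 t := ⟨ha, hat⟩
  have h0t' : (0:ℝ) ∈ Icc 0 t := ⟨le_rfl, ha.trans hat⟩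
  have htt' : t ∈ Icc 0 t := ⟨ha.trans hat, le_rfl⟩
  have hint : ∀ x ∈ Icc 0 t, ∀ y ∈ Icc 0 t, IntervalIntegrable
      (fun s => (t - s) ^ (γ - 1) * f (u s)) volume x y := by
    intro x hx y hy
    apply kern_mul_int hγ
    exact hfc.comp_continuousOn (hct.mono (uIcc_subset_Icc hx hy))
  have hspl := intervalIntegral.integral_add_adjacent_intervals (hint 0 h0t' a hat')
        (hint a hat' t htt')
  have h1 : 0 ≤ ∫ s in (0:ℝ)..a, (t - s) ^ (γ - 1) * f (u s) := by
    apply intervalIntegral.integral_nonneg ha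
    intro s hs
    have hs' := hsub (a := s) ⟨hs.1, hs.2.trans hat⟩
    exact mul_nonneg (Real.rpow_nonneg (by linarith [hs.2]) _) (hpos _ (hD s hs'.1 hs'.2)).le
  have h2 : f (u a) * ((t - a) ^ γ / γ) ≤ ∫ s in a..t, (t - s) ^ (γ - 1) * f (u s) := by
    rw [← kern_val hγ, ← intervalIntegral.integral_const_mul]
    apply intervalIntegral.integral_mono_on hat
    · exact (kern_int hγ _ _ _).const_mul _
    · exact hint a hat' t htt'
    · intro s hs
      have hs' := hsub (a := s) ⟨ha.trans hs.1, hs.2⟩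
      have ha' := hsub hat'
      rw [mul_comm]
      apply mul_le_mul_of_nonneg_left _ (Real.rpow_nonneg (by linarith [hs.2]) _)
      exact hf (Ioi_subset_Ici_self (hD a ha'.1 ha'.2))
        (Ioi_subset_Ici_self (hD s hs'.1 hs'.2)) (hmono ha' hs' hs.1)
  gcongr
  linarith

lemma pow_lip_Icc {p A u₀ M : ℝ} (hu₀ : 0 < u₀) (hM : u₀ ≤ M) :
    ∃ K, LipschitzWith K (fun x : ℝ => A * (max u₀ (min M x)) ^ p) := by
  have hne : ∀ x ∈ Icc u₀ M, x ≠ 0 := fun x hx => by linarith [hx.1]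
  obtain ⟨C, hC⟩ := (isCompact_Icc (a := u₀) (b := M)).exists_bound_of_continuousOn
    (f := fun x : ℝ => A * (p * x ^ (p - 1)))
    (by
      apply continuousOn_const.mul (continuousOn_const.mul _)
      exact continuousOn_id.rpow_const (fun x hx => Or.inl (hne x hx)))
  have h1 : LipschitzOnWith C.toNNReal (fun x : ℝ => A * x ^ p) (Icc u₀ M) := by
    apply (convex_Icc u₀ M).lipschitzOnWith_of_nnnorm_hasDerivWithin_le
      (f' := fun x : ℝ => A * (p * x ^ (p - 1)))
    · intro x hx
      exact ((Real.hasDerivAt_rpow_const (Or.inl (hne x hx))).const_mul A).hasDerivWithinAt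
    · intro x hx
      rw [← NNReal.coe_le_coe, coe_nnnorm]
      exact (hC x hx).trans (Real.le_coe_toNNReal C)
  have h2 : LipschitzWith 1 (fun x : ℝ => max u₀ (min M x)) :=
    ((LipschitzWith.id (α := ℝ)).const_min M).const_max u₀
  refine ⟨C.toNNReal * 1, ?_⟩
  rw [← lipschitzOnWith_univ] at h2 ⊢
  exact h1.comp h2 (fun x _ => ⟨le_max_left _ _, max_le hM (min_le_left _ _)⟩)

lemma pow_lip_Ici {p A u₀ : ℝ} (hp : 0 ≤ p) (hp1 : p ≤ 1) (hA : 0 < A) (hu₀ : 0 < u₀) :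
    ∃ K, LipschitzWith K (fun x : ℝ => A * (max u₀ x) ^ p) := by
  have h1 : LipschitzOnWith (A * (p * u₀ ^ (p - 1))).toNNReal (fun x : ℝ => A * x ^ p)
      (Ici u₀) := by
    apply (convex_Ici u₀).lipschitzOnWith_of_nnnorm_hasDerivWithin_le
      (f' := fun x : ℝ => A * (p * x ^ (p - 1)))
    · intro x hx
      have hx : u₀ ≤ x := hx
      exact ((Real.hasDerivAt_rpow_const (Or.inl (by linarith))).const_mul A).hasDerivWithinAt
    · intro x hx
      have hx : u₀ ≤ x := hx
      have hx0 : 0 < x := by linarith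
      rw [← NNReal.coe_le_coe, coe_nnnorm, Real.norm_of_nonneg (by positivity)]
      refine le_trans ?_ (Real.le_coe_toNNReal _)
      have := Real.rpow_le_rpow_of_nonpos hu₀ hx (by linarith : p - 1 ≤ 0)
      gcongr
  have h2 : LipschitzWith 1 (fun x : ℝ => max u₀ x) :=
    (LipschitzWith.id (α := ℝ)).const_max u₀
  refine ⟨(A * (p * u₀ ^ (p - 1))).toNNReal * 1, ?_⟩
  rw [← lipschitzOnWith_univ] at h2 ⊢
  exact h1.comp h2 (fun x _ => le_max_left u₀ x)

lemma continuation {p A u₀ M τ : ℝ} {u : ℝ → ℝ} (hγ : 0 < γ) (hA : 0 < A)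
    (hu₀ : 0 < u₀) (hM : u₀ ≤ M) (hτ : 0 ≤ τ)
    (hu : IsSolUpTo γ (fun x => A * x ^ p) (Ioi 0) u₀ u (ENNReal.ofReal τ))
    (hb : ∀ t, 0 ≤ t → t < τ → u t ≤ M) :
    ∃ τ' > τ, ∃ v, IsSolUpTo γ (fun x => A * x ^ p) (Ioi 0) u₀ v (ENNReal.ofReal τ') := by
  obtain ⟨K, hK⟩ := pow_lip_Icc (p := p) (A := A) hu₀ (by linarith : u₀ ≤ M + 1)
  obtain ⟨v, hvc, hv⟩ := volt_exists hγ hK u₀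
  have hcl : ∀ x, u₀ ≤ x → x ≤ M + 1 → max u₀ (min (M + 1) x) = x := by
    intro x h1 h2
    rw [min_eq_right h2, max_eq_right h1]
  have hv0 : ∀ t, 0 ≤ t → u₀ ≤ v t := by
    intro t ht
    rw [hv t ht]
    have := volt_nonneg hγ ht (φ := fun s => A * (max u₀ (min (M + 1) (v s))) ^ p) (by
      intro s _
      have : 0 < max u₀ (min (M + 1) (v s)) := lt_max_of_lt_left hu₀
      positivity)
    linarith
  obtain ⟨hu0, huc, huD, huv⟩ := hu
  have hlt : ∀ t, 0 ≤ t → t < τ → ENNReal.ofReal t < ENNReal.ofReal τ := fun t h0 h =>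
    (ENNReal.ofReal_lt_ofReal_iff_of_nonneg h0).mpr h
  have hu_ge : ∀ t, 0 ≤ t → t < τ → u₀ ≤ u t := by
    intro t h0 h
    rw [huv t h0 (hlt t h0 h)]
    have := volt_nonneg hγ h0 (φ := fun s => A * (u s) ^ p) (by
      intro s hs
      have : 0 < u s := huD s hs.1 (hlt s hs.1 (hs.2.trans_lt h))
      positivity)
    linarith
  have heq : ∀ t, 0 ≤ t → t < τ → u t = v t := by
    intro t h0 h
    refine volt_unique hγ hK (a := u) (b := v) (T := t) (u₀ := u₀)
      (huc.mono (dom_sub (hlt t h0 h))) hvc.continuousOn ?_ (fun s hs => hv s hs.1) t ⟨h0, le_rfl⟩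
    intro s hs
    have hsτ : s < τ := hs.2.trans_lt h
    rw [huv s hs.1 (hlt s hs.1 hsτ)]
    congr 2
    apply intervalIntegral.integral_congr
    intro r hr
    rw [uIcc_of_le hs.1] at hr
    have hrτ := hr.2.trans_lt hsτ
    simp only
    rw [hcl _ (hu_ge r hr.1 hrτ) ((hb r hr.1 hrτ).trans (by linarith))]
  have hvτ : ∀ t, 0 ≤ t → t ≤ τ → v t ≤ M := by
    have hlt' : ∀ t, 0 ≤ t → t < τ → v t ≤ M := fun t h0 h => by
      rw [← heq t h0 h]; exact hb t h0 h
    intro t h0 h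
    rcases h.lt_or_eq with h | rfl
    · exact hlt' t h0 h
    rcases h0.eq_or_lt with rfl | h0
    · rw [hv 0 le_rfl]; simpa using hM
    · have hcl : t ∈ closure (Ico 0 t) := by
        rw [closure_Ico h0.ne]; exact ⟨h0.le, le_rfl⟩
      exact le_on_closure (f := v) (g := fun _ => M) (fun s hs => hlt' s hs.1 hs.2)
        hvc.continuousOn continuousOn_const hcl
  have hev : ∀ᶠ t in 𝓝 τ, v t < M + 1 :=
    hvc.continuousAt.eventually_lt continuousAt_const (by linarith [hvτ τ hτ le_rfl])
  obtain ⟨δ, hδ, hball⟩ := Metric.eventually_nhds_iff.mp hev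
  have hvM : ∀ t, 0 ≤ t → t < τ + δ → v t ≤ M + 1 := by
    intro t h0 h
    rcases le_or_gt t τ with h1 | h1
    · linarith [hvτ t h0 h1]
    · apply le_of_lt
      apply hball
      rw [Real.dist_eq, abs_lt]
      constructor <;> linarith
  refine ⟨τ + δ, by linarith, v, ?_, hvc.continuousOn, ?_, ?_⟩
  · rw [hv 0 le_rfl]; simp
  · intro t h0 _
    exact hu₀.trans_le (hv0 t h0)
  · intro t h0 h
    have h := (ENNReal.ofReal_lt_ofReal_iff_of_nonneg h0).mp h
    rw [hv t h0]
    congr 2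
    apply intervalIntegral.integral_congr
    intro r hr
    rw [uIcc_of_le h0] at hr
    simp only
    rw [hcl _ (hv0 r hr.1) (hvM r hr.1 (hr.2.trans_lt h))]

lemma global_of_le_one {p A u₀ : ℝ} (hγ : 0 < γ) (hp : 0 ≤ p) (hp1 : p ≤ 1) (hA : 0 < A)
    (hu₀ : 0 < u₀) :
    ∃ v, IsSolUpTo γ (fun x => A * x ^ p) (Ioi 0) u₀ v ⊤ := by
  obtain ⟨K, hK⟩ := pow_lip_Ici hp hp1 hA hu₀
  obtain ⟨v, hvc, hv⟩ := volt_exists hγ hK u₀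
  have hv0 : ∀ t, 0 ≤ t → u₀ ≤ v t := by
    intro t ht
    rw [hv t ht]
    have := volt_nonneg hγ ht (φ := fun s => A * (max u₀ (v s)) ^ p) (by
      intro s _
      have : 0 < max u₀ (v s) := lt_max_of_lt_left hu₀
      positivity)
    linarith
  refine ⟨v, ?_, hvc.continuousOn, ?_, ?_⟩
  · rw [hv 0 le_rfl]; simp
  · intro t h0 _
    exact hu₀.trans_le (hv0 t h0)
  · intro t h0 h
    rw [hv t h0]
    congr 2
    apply intervalIntegral.integral_congr
    intro r hr
    rw [uIcc_of_le h0] at hr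
    simp only
    rw [max_eq_right (hv0 r hr.1)]

lemma blowup_s10 {p A u₀ : ℝ} {u : ℝ → ℝ} (hγ : 0 < γ) (hp : 1 < p) (hA : 0 < A)
    (hu₀ : 0 < u₀) (hmono : MonotoneOn u (Ici 0)) (hu0 : u 0 = u₀)
    (hlow : ∀ a t, 0 ≤ a → a ≤ t →
      u₀ + (1 / Real.Gamma γ) * ((A * u a ^ p) * ((t - a) ^ γ / γ)) ≤ u t) : False := by
  have hG := Real.Gamma_pos_of_pos hγ
  set K : ℝ := 2 * u₀ * γ * Real.Gamma γ / (A * u₀ ^ p) with hK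
  have hK0 : 0 < K := by positivity
  set κ : ℝ := K ^ (1 / γ) with hκ
  have hκ0 : 0 < κ := by positivity
  set r : ℝ := (2:ℝ) ^ ((1 - p) / γ) with hr
  have hr0 : 0 < r := by positivity
  have hr1 : r < 1 := Real.rpow_lt_one_of_one_lt_of_neg (by norm_num)
    (div_neg_of_neg_of_pos (by linarith) hγ)
  let τ : ℕ → ℝ := fun n => κ * ∑ i ∈ Finset.range n, r ^ i
  have hτ0 : ∀ n, 0 ≤ τ n := fun n => by
    apply mul_nonneg hκ0.le (Finset.sum_nonneg fun i _ => by positivity)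
  have hτs : ∀ n, τ (n + 1) = τ n + κ * r ^ n := fun n => by
    simp only [τ, Finset.sum_range_succ, mul_add]
  have hstep : ∀ n : ℕ, (2:ℝ) ^ n * u₀ ≤ u (τ n) := by
    intro n
    induction n with
    | zero => simp [τ, hu0]
    | succ n ih =>
      have h1 := hlow (τ n) (τ (n + 1)) (hτ0 n) (by rw [hτs]; linarith [mul_pos hκ0 (pow_pos hr0 n)])
      rw [hτs, add_sub_cancel_left] at h1
      rw [hτs]
      refine le_trans ?_ h1
      set q : ℝ := (2:ℝ) ^ n with hq
      have hq0 : 0 < q := by positivity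
      have hrq : (κ * r ^ n) ^ γ = K * q ^ (1 - p) := by
        rw [Real.mul_rpow hκ0.le (by positivity), hκ, ← Real.rpow_mul hK0.le,
          one_div_mul_cancel hγ.ne', Real.rpow_one, hr, hq]
        congr 1
        rw [← Real.rpow_natCast, ← Real.rpow_natCast, ← Real.rpow_mul (by positivity),
          ← Real.rpow_mul (by positivity), ← Real.rpow_mul (by positivity)]
        congr 1
        field_simp
      have hup : q ^ p * u₀ ^ p ≤ u (τ n) ^ p := by
        rw [← Real.mul_rpow hq0.le hu₀.le]
        exact Real.rpow_le_rpow (by positivity) ih (by linarith)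
      have hqq : q ^ p * q ^ (1 - p) = q := by
        rw [← Real.rpow_add hq0]; simp
      have h2 : (2:ℝ) ^ (n + 1) * u₀ =
          (1 / Real.Gamma γ) * ((A * (q ^ p * u₀ ^ p)) * ((κ * r ^ n) ^ γ / γ)) := by
        have : (1 / Real.Gamma γ) * ((A * (q ^ p * u₀ ^ p)) * ((κ * r ^ n) ^ γ / γ))
          = (q ^ p * q ^ (1 - p)) * ((1 / Real.Gamma γ) * (A * u₀ ^ p) * (K / γ)) := by
          rw [hrq]; ring
        rw [this, hqq, hK, pow_succ, ← hq]
        have : 0 < u₀ ^ p := by positivity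
        field_simp
      rw [h2]
      have h3 : (1 / Real.Gamma γ) * ((A * (q ^ p * u₀ ^ p)) * ((κ * r ^ n) ^ γ / γ)) ≤
        (1 / Real.Gamma γ) * ((A * u (τ n) ^ p) * ((κ * r ^ n) ^ γ / γ)) := by gcongr
      linarith
  have hsum := summable_geometric_of_lt_one hr0.le hr1
  have hall : ∀ n : ℕ, (2:ℝ) ^ n * u₀ ≤ u (κ * ∑' i : ℕ, r ^ i) := by
    intro n
    refine (hstep n).trans (hmono (hτ0 n) ?_ ?_)
    · exact mul_nonneg hκ0.le (tsum_nonneg fun i => by positivity)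
    · exact mul_le_mul_of_nonneg_left (hsum.sum_le_tsum _ (fun i _ => by positivity)) hκ0.le
  obtain ⟨n, hn⟩ := pow_unbounded_of_one_lt (u (κ * ∑' i : ℕ, r ^ i) / u₀)
    (by norm_num : (1:ℝ) < 2)
  rw [div_lt_iff₀ hu₀] at hn
  linarith [hall n]

end main

/-- behavior of solutions of `D_c^γ u = A u^p` with `A > 0`, `p ≥ 0`. -/
theorem stmt10 (γ p A u₀ : ℝ) (u : ℝ → ℝ)
    (hγ : γ ∈ Set.Ioo (0:ℝ) 1) (hp : 0 ≤ p) (hA : 0 < A) (hu₀ : 0 < u₀)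
    (hu : IsSolUpTo γ (fun x => A * x ^ p) (Set.Ioi 0) u₀ u
      (maxTime γ (fun x => A * x ^ p) (Set.Ioi 0) u₀)) :
    -- (1) u is increasing and tends to ∞ at the maximal time
    StrictMonoOn u
      {t : ℝ | 0 ≤ t ∧ ENNReal.ofReal t < maxTime γ (fun x => A * x ^ p) (Set.Ioi 0) u₀} ∧
    (maxTime γ (fun x => A * x ^ p) (Set.Ioi 0) u₀ = ⊤ → Tendsto u atTop atTop) ∧
    (maxTime γ (fun x => A * x ^ p) (Set.Ioi 0) u₀ ≠ ⊤ →
      Tendsto u (𝓝[<] (maxTime γ (fun x => A * x ^ p) (Set.Ioi 0) u₀).toReal) atTop) ∧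
    -- (2) solution curves with distinct nonnegative initial values do not intersect
    (∀ (v₀ : ℝ) (v : ℝ → ℝ) (T : ℝ≥0∞), 0 ≤ v₀ → v₀ ≠ u₀ →
      IsSolUpTo γ (fun x => A * x ^ p) (Set.Ici 0) v₀ v T →
      ∀ t : ℝ, 0 ≤ t →
        ENNReal.ofReal t < min T (maxTime γ (fun x => A * x ^ p) (Set.Ioi 0) u₀) →
        v t ≠ u t) ∧
    -- (3) global existence for 0 ≤ p ≤ 1
    (p ≤ 1 → maxTime γ (fun x => A * x ^ p) (Set.Ioi 0) u₀ = ⊤) ∧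
    -- (4) finite-time blow-up for p > 1
    (1 < p → maxTime γ (fun x => A * x ^ p) (Set.Ioi 0) u₀ < ⊤) := by
  have hγ0 := hγ.1
  have hG := Real.Gamma_pos_of_pos hγ0
  have hfc : Continuous (fun x : ℝ => A * x ^ p) :=
    continuous_const.mul (Real.continuous_rpow_const hp)
  have hfm : MonotoneOn (fun x : ℝ => A * x ^ p) (Ici 0) := fun x hx y _ hxy =>
    mul_le_mul_of_nonneg_left (Real.rpow_le_rpow hx hxy hp) hA.le
  have hpos : ∀ x : ℝ, 0 < x → 0 < A * x ^ p := fun x hx => by positivity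
  have hmono := sol_strictMono hγ0 hfc hfm hpos hu
  have hlow := fun a t => sol_lower hγ0 hfc hfm hpos hu (a := a) (t := t)
  generalize hTb : maxTime γ (fun x => A * x ^ p) (Set.Ioi 0) u₀ = Tb at *
  have hle : ∀ T v, IsSolUpTo γ (fun x => A * x ^ p) (Set.Ioi 0) u₀ v T → T ≤ Tb := by
    intro T v hv
    rw [← hTb]
    exact le_sSup ⟨v, hv⟩
  refine ⟨hmono, ?_, ?_, ?_, ?_, ?_⟩
  · intro htop
    have h1 : ∀ t, 0 ≤ t → u₀ + (1 / Real.Gamma γ) * ((A * u 0 ^ p) * (t ^ γ / γ)) ≤ u t := by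
      intro t ht
      have := hlow 0 t le_rfl ht (by rw [htop]; exact ENNReal.ofReal_lt_top)
      simpa using this
    have h2 : Tendsto (fun t : ℝ => u₀ + (1 / Real.Gamma γ) * ((A * u 0 ^ p) * (t ^ γ / γ)))
        atTop atTop := by
      apply tendsto_atTop_add_const_left
      apply Tendsto.const_mul_atTop (by positivity)
      apply Tendsto.const_mul_atTop
      · rw [hu.1]; positivity
      · exact (tendsto_rpow_atTop hγ0).atTop_div_const hγ0
    apply tendsto_atTop_mono' _ _ h2
    filter_upwards [eventually_ge_atTop 0] with t ht using h1 t ht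
  · intro hne
    have hTr : ENNReal.ofReal Tb.toReal = Tb := ENNReal.ofReal_toReal hne
    have hunb : ∀ M : ℝ, ∃ t, (0 ≤ t ∧ ENNReal.ofReal t < Tb) ∧ M < u t := by
      by_contra! hcon
      obtain ⟨M, hM⟩ := hcon
      obtain ⟨τ', hτ', v, hv⟩ := continuation (M := max u₀ M) (τ := Tb.toReal) (u := u) (p := p)
        hγ0 hA hu₀ (le_max_left _ _) ENNReal.toReal_nonneg (by rw [hTr]; exact hu)
        (fun t h0 h => (hM t ⟨h0, by
          rw [← hTr]; exact (ENNReal.ofReal_lt_ofReal_iff_of_nonneg h0).mpr h⟩).trans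
          (le_max_right _ _))
      have := hle _ v hv
      rw [← hTr] at this
      have := (ENNReal.ofReal_le_ofReal_iff ENNReal.toReal_nonneg).mp this
      linarith
    rw [tendsto_atTop]
    intro M
    obtain ⟨t, ht, hMt⟩ := hunb M
    have htT : t < Tb.toReal := (ENNReal.ofReal_lt_iff_lt_toReal ht.1 hne).mp ht.2
    filter_upwards [Ioo_mem_nhdsLT htT] with s hs
    have hs0 : 0 ≤ s := ht.1.trans hs.1.le
    have := hmono ht ⟨hs0, (ENNReal.ofReal_lt_iff_lt_toReal hs0 hne).mpr hs.2⟩ hs.1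
    linarith
  · intro v₀ v T hv₀ hne hv t ht htT heq
    have hsv := dom_sub (lt_min_iff.mp htT).1
    have hsu := dom_sub (lt_min_iff.mp htT).2
    obtain ⟨-, huc, huD, huv⟩ := hu
    obtain ⟨-, hvc, hvD, hvv⟩ := hv
    have hut : ∀ s ∈ Icc 0 t, 0 ≤ u s := fun s hs => le_of_lt (huD s hs.1 (hsu hs).2)
    have hvt : ∀ s ∈ Icc 0 t, 0 ≤ v s := fun s hs => hvD s hs.1 (hsv hs).2
    rcases lt_or_gt_of_ne hne with h | h
    · have := volt_cmp hγ0 hfc hfm (a := v) (b := u) (T := t) (α := fun _ => v₀)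
        (β := fun _ => u₀) (hvc.mono hsv) (huc.mono hsu) hvt hut
        (fun s hs => hvv s hs.1 (hsv hs).2) (fun s hs => huv s hs.1 (hsu hs).2)
        (fun _ _ => h) t ⟨ht, le_rfl⟩
      linarith
    · have := volt_cmp hγ0 hfc hfm (a := u) (b := v) (T := t) (α := fun _ => u₀)
        (β := fun _ => v₀) (huc.mono hsu) (hvc.mono hsv) hut hvt
        (fun s hs => huv s hs.1 (hsu hs).2) (fun s hs => hvv s hs.1 (hsv hs).2)
        (fun _ _ => h) t ⟨ht, le_rfl⟩
      linarith
  · intro hp1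
    obtain ⟨v, hv⟩ := global_of_le_one hγ0 hp hp1 hA hu₀
    exact top_le_iff.mp (hle _ v hv)
  · intro hp1
    by_contra hcon
    have htop : Tb = ⊤ := by
      rw [not_lt, top_le_iff] at hcon
      exact hcon
    subst htop
    refine blowup_s10 hγ0 hp1 hA hu₀ (hmono.monotoneOn.mono ?_) hu.1
      (fun a t ha hat => hlow a t ha hat ENNReal.ofReal_lt_top)
    intro x hx
    exact ⟨hx, ENNReal.ofReal_lt_top⟩
end

section
/- Let γ ∈ (0,1), p > 1, A > 0, u₀ > 0, and let T_b < ∞ be the blow-up time of the solution of D_c^γ u = A u^p, u(0) = u₀. Then (Γ(1+γ)/(A u₀^{p−1}))^{1/γ} · sup_{r>1} (r^γ − 1)^{1/γ} / (r(r^{p−1} − 1)) ≤ T_b ≤ (Γ(1+γ)/(A u₀^{p−1}))^{1/γ} · inf_{r>1, m∈ℤ₊} [ r^p / (r^{(m+1)(p−1)} − r^{m(p−1)}) + ((1 − r^{mγ(1−p)})/(p−1))^{1/γ} ]. -/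
open MeasureTheory Real Filter Set Asymptotics
open scoped ENNReal Topology

lemma ker_int {γ : ℝ} (h0 : 0 < γ) (t a b : ℝ) :
    IntervalIntegrable (fun s : ℝ => (t - s) ^ (γ - 1)) volume a b := by
  have h := (intervalIntegral.intervalIntegrable_rpow' (a := t - a) (b := t - b)
    (r := γ - 1) (by linarith)).comp_sub_left t
  simpa using h

lemma ker_val {γ : ℝ} (h0 : 0 < γ) (t a b : ℝ) :
    ∫ s in a..b, (t - s) ^ (γ - 1) = ((t - a) ^ γ - (t - b) ^ γ) / γ := by
  rw [intervalIntegral.integral_comp_sub_left (fun x : ℝ => x ^ (γ - 1)) t,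
    integral_rpow (Or.inl (by linarith))]
  simp

lemma kerF_int {γ : ℝ} (h0 : 0 < γ) {F : ℝ → ℝ} (t a b : ℝ) (hab : a ≤ b)
    (hF : ContinuousOn F (Icc a b)) :
    IntervalIntegrable (fun s : ℝ => (t - s) ^ (γ - 1) * F s) volume a b :=
  (ker_int h0 t a b).mul_continuousOn (by rwa [uIcc_of_le hab])

/-- upper bound of kernel integral -/
lemma kerF_le {γ : ℝ} (h0 : 0 < γ) {F : ℝ → ℝ} {t a b M : ℝ} (hab : a ≤ b) (hbt : b ≤ t)
    (hF : ContinuousOn F (Icc a b)) (hM : ∀ s ∈ Icc a b, F s ≤ M) :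
    ∫ s in a..b, (t - s) ^ (γ - 1) * F s ≤ M * (((t - a) ^ γ - (t - b) ^ γ) / γ) := by
  rw [← ker_val h0, ← intervalIntegral.integral_const_mul]
  apply intervalIntegral.integral_mono_on hab (kerF_int h0 t a b hab hF)
    ((ker_int h0 t a b).const_mul M)
  intro s hs
  rw [mul_comm]
  exact mul_le_mul_of_nonneg_right (hM s hs) (rpow_nonneg (by linarith [hs.2]) _)

lemma le_kerF {γ : ℝ} (h0 : 0 < γ) {F : ℝ → ℝ} {t a b M : ℝ} (hab : a ≤ b) (hbt : b ≤ t)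
    (hF : ContinuousOn F (Icc a b)) (hM : ∀ s ∈ Icc a b, M ≤ F s) :
    M * (((t - a) ^ γ - (t - b) ^ γ) / γ) ≤ ∫ s in a..b, (t - s) ^ (γ - 1) * F s := by
  rw [← ker_val h0, ← intervalIntegral.integral_const_mul]
  apply intervalIntegral.integral_mono_on hab ((ker_int h0 t a b).const_mul M)
    (kerF_int h0 t a b hab hF)
  intro s hs
  rw [mul_comm _ (F s)]
  exact mul_le_mul_of_nonneg_right (hM s hs) (rpow_nonneg (by linarith [hs.2]) _)

/-- working form of solutions on a compact interval -/
structure SolOn (γ p A u₀ : ℝ) (u : ℝ → ℝ) (S : ℝ) : Prop where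
  cont : ContinuousOn u (Icc 0 S)
  pos : ∀ t ∈ Icc 0 S, 0 < u t
  eq : ∀ t ∈ Icc 0 S, u t = u₀ + (1 / Real.Gamma γ) *
    ∫ s in (0:ℝ)..t, (t - s) ^ (γ - 1) * (A * u s ^ p)

lemma SolOn.contF {γ p A u₀ : ℝ} {u : ℝ → ℝ} {S : ℝ} (h : SolOn γ p A u₀ u S) :
    ContinuousOn (fun s => A * u s ^ p) (Icc 0 S) :=
  continuousOn_const.mul (h.cont.rpow_const fun t ht => Or.inl (h.pos t ht).ne')

lemma SolOn.mono {γ p A u₀ : ℝ} {u : ℝ → ℝ} {S : ℝ} (h : SolOn γ p A u₀ u S)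
    (h0 : 0 < γ) (hp : 1 < p) (hA : 0 < A) : MonotoneOn u (Icc 0 S) := by
  have key : ∀ d, 0 < d → ∀ t ∈ Icc 0 (S - d), u t < u (t + d) := by
    intro d hd
    by_contra hcon
    push Not at hcon
    have hcs : ContinuousOn (fun t => u (t + d)) (Icc 0 (S - d)) :=
      h.cont.comp (by fun_prop) (fun t ht => ⟨by linarith [ht.1], by linarith [ht.2]⟩)
    have hcu : ContinuousOn u (Icc 0 (S - d)) :=
      h.cont.mono (Icc_subset_Icc le_rfl (by linarith))
    have hcl : IsClosed {t | t ∈ Icc 0 (S - d) ∧ u (t + d) ≤ u t} :=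
      isClosed_Icc.isClosed_le hcs hcu
    have hcpt : IsCompact {t | t ∈ Icc 0 (S - d) ∧ u (t + d) ≤ u t} :=
      isCompact_Icc.of_isClosed_subset hcl (fun t ht => ht.1)
    obtain ⟨t1, ht1, ht1'⟩ := hcon
    obtain ⟨t0, ⟨ht0, hle⟩, hmin⟩ := hcpt.exists_isLeast ⟨t1, ht1, ht1'⟩
    have hlt : ∀ s, 0 ≤ s → s < t0 → u s < u (s + d) := by
      intro s hs hst
      by_contra hh
      have := hmin ⟨⟨hs, by linarith [ht0.2]⟩, not_lt.1 hh⟩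
      linarith
    have e1 := h.eq t0 ⟨ht0.1, by linarith [ht0.2]⟩
    have e2 := h.eq (t0 + d) ⟨by linarith [ht0.1], by linarith [ht0.2]⟩
    have i1 : IntervalIntegrable (fun s => (t0 + d - s) ^ (γ - 1) * (A * u s ^ p)) volume 0 d :=
      kerF_int h0 _ _ _ hd.le (h.contF.mono (Icc_subset_Icc le_rfl (by linarith [ht0.1, ht0.2])))
    have i2 : IntervalIntegrable (fun s => (t0 + d - s) ^ (γ - 1) * (A * u s ^ p)) volume
        d (t0 + d) :=
      kerF_int h0 _ _ _ (by linarith [ht0.1])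
        (h.contF.mono (Icc_subset_Icc hd.le (by linarith [ht0.2])))
    rw [← intervalIntegral.integral_add_adjacent_intervals i1 i2] at e2
    have p1 : 0 < ∫ s in (0:ℝ)..d, (t0 + d - s) ^ (γ - 1) * (A * u s ^ p) := by
      apply intervalIntegral.intervalIntegral_pos_of_pos_on i1 _ hd
      intro s hs
      have := h.pos s ⟨hs.1.le, by linarith [hs.2, ht0.1, ht0.2]⟩
      have : 0 < t0 + d - s := by linarith [hs.2, ht0.1]
      positivity
    have e3 : ∫ s in d..(t0 + d), (t0 + d - s) ^ (γ - 1) * (A * u s ^ p) =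
        ∫ s in (0:ℝ)..t0, (t0 - s) ^ (γ - 1) * (A * u (s + d) ^ p) := by
      have := intervalIntegral.integral_comp_add_right (a := 0) (b := t0)
        (fun s => (t0 + d - s) ^ (γ - 1) * (A * u s ^ p)) d
      rw [zero_add] at this
      rw [← this]
      congr 1; ext s; congr 2; ring
    have p2 : ∫ s in (0:ℝ)..t0, (t0 - s) ^ (γ - 1) * (A * u s ^ p) ≤
        ∫ s in (0:ℝ)..t0, (t0 - s) ^ (γ - 1) * (A * u (s + d) ^ p) := by
      apply intervalIntegral.integral_mono_on_of_le_Ioo ht0.1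
      · exact kerF_int h0 _ _ _ ht0.1
          (h.contF.mono (Icc_subset_Icc le_rfl (by linarith [ht0.2])))
      · apply kerF_int h0 (F := fun s => A * u (s + d) ^ p) _ _ _ ht0.1
        exact h.contF.comp (f := fun s => s + d) (by fun_prop)
          (fun s hs => ⟨by linarith [hs.1], by linarith [hs.2, ht0.2]⟩)
      · intro s hs
        have h1 := hlt s hs.1.le hs.2
        have h2 := h.pos s ⟨hs.1.le, by linarith [hs.2, ht0.2]⟩
        have h3 : 0 < t0 - s := by linarith [hs.2]
        gcongr
    rw [← e3] at p2
    have hG : 0 < 1 / Real.Gamma γ := by have := Gamma_pos_of_pos h0; positivity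
    have := mul_lt_mul_of_pos_left (add_lt_add_of_lt_of_le p1 p2) hG
    rw [zero_add] at this
    linarith
  intro a ha b hb hab
  rcases hab.eq_or_lt with rfl | hlt
  · exact le_rfl
  · have := key (b - a) (by linarith) a ⟨ha.1, by linarith [hb.2]⟩
    simpa using this.le

lemma cheb {γ : ℝ} (h0 : 0 < γ) (h1 : γ < 1) {F : ℝ → ℝ} {t : ℝ} (ht : 0 ≤ t)
    (hF : ContinuousOn F (Icc 0 t)) (hm : MonotoneOn F (Icc 0 t)) :
    ∫ s in (0:ℝ)..t, s ^ (γ - 1) * F s ≤ ∫ s in (0:ℝ)..t, (t - s) ^ (γ - 1) * F s := by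
  have hF' : ContinuousOn (fun s => F (t - s)) (Icc 0 t) :=
    hF.comp (by fun_prop) (fun s hs => ⟨by linarith [hs.2], by linarith [hs.1]⟩)
  have k0 : IntervalIntegrable (fun s : ℝ => s ^ (γ - 1)) volume 0 t :=
    intervalIntegral.intervalIntegrable_rpow' (by linarith)
  have i1 : IntervalIntegrable (fun s : ℝ => s ^ (γ - 1) * F s) volume 0 t :=
    k0.mul_continuousOn (by rwa [uIcc_of_le ht])
  have i2 : IntervalIntegrable (fun s : ℝ => s ^ (γ - 1) * F (t - s)) volume 0 t :=
    k0.mul_continuousOn (by rwa [uIcc_of_le ht])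
  have i3 := kerF_int h0 t 0 t ht hF
  have i4 := kerF_int h0 t 0 t ht hF'
  have e1 : ∫ s in (0:ℝ)..t, s ^ (γ - 1) * F (t - s) = ∫ s in (0:ℝ)..t, (t - s) ^ (γ - 1) * F s := by
    have := intervalIntegral.integral_comp_sub_left (a := 0) (b := t)
      (fun s => (t - s) ^ (γ - 1) * F s) t
    simpa using this
  have e2 : ∫ s in (0:ℝ)..t, (t - s) ^ (γ - 1) * F (t - s) = ∫ s in (0:ℝ)..t, s ^ (γ - 1) * F s := by
    have := intervalIntegral.integral_comp_sub_left (a := 0) (b := t)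
      (fun s => s ^ (γ - 1) * F s) t
    simpa using this
  have key : ∫ s in (0:ℝ)..t, (s ^ (γ - 1) * F s + (t - s) ^ (γ - 1) * F (t - s)) ≤
      ∫ s in (0:ℝ)..t, (s ^ (γ - 1) * F (t - s) + (t - s) ^ (γ - 1) * F s) := by
    apply intervalIntegral.integral_mono_on_of_le_Ioo ht (i1.add i4) (i2.add i3)
    intro s hs
    have m1 : s ∈ Icc 0 t := ⟨hs.1.le, hs.2.le⟩
    have m2 : t - s ∈ Icc 0 t := ⟨by linarith [hs.2], by linarith [hs.1]⟩
    have hs2 : 0 < t - s := by linarith [hs.2]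
    rcases le_total s (t - s) with hh | hh
    · have a1 := hm m1 m2 hh
      have a2 := rpow_le_rpow_of_nonpos hs.1 hh (by linarith : γ - 1 ≤ 0)
      nlinarith [mul_nonneg (sub_nonneg.2 a1) (sub_nonneg.2 a2)]
    · have a1 := hm m2 m1 hh
      have a2 := rpow_le_rpow_of_nonpos hs2 hh (by linarith : γ - 1 ≤ 0)
      nlinarith [mul_nonneg (sub_nonneg.2 a1) (sub_nonneg.2 a2)]
  rw [intervalIntegral.integral_add i1 i4, intervalIntegral.integral_add i2 i3, e1, e2] at key
  linarith

lemma SolOn.step {γ p A u₀ : ℝ} {u : ℝ → ℝ} {S : ℝ} (h : SolOn γ p A u₀ u S)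
    (h0 : 0 < γ) (hp : 1 < p) (hA : 0 < A) (hu : 0 < u₀) {s t : ℝ} (hs : 0 ≤ s) (hst : s ≤ t)
    (htS : t ≤ S) : A / Real.Gamma (1 + γ) * u s ^ p * (t - s) ^ γ ≤ u t := by
  have hG := Gamma_pos_of_pos h0
  have hG1 : Real.Gamma (1 + γ) = γ * Real.Gamma γ := by
    rw [add_comm, Real.Gamma_add_one h0.ne']
  have us := h.pos s ⟨hs, by linarith⟩
  rw [h.eq t ⟨by linarith, htS⟩]
  have c1 : ContinuousOn (fun s => A * u s ^ p) (Icc 0 s) :=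
    h.contF.mono (Icc_subset_Icc le_rfl (by linarith))
  have c2 : ContinuousOn (fun s => A * u s ^ p) (Icc s t) :=
    h.contF.mono (Icc_subset_Icc hs htS)
  have l1 := le_kerF (M := 0) h0 (t := t) hs hst c1
    (fun x hx => by have := h.pos x ⟨hx.1, by linarith [hx.2]⟩; positivity)
  have l2 := le_kerF (M := A * u s ^ p) h0 (t := t) hst le_rfl c2
    (fun x hx => by
      have := h.mono h0 hp hA ⟨hs, by linarith⟩ ⟨by linarith [hx.1], by linarith [hx.2]⟩ hx.1
      gcongr)
  rw [← intervalIntegral.integral_add_adjacent_intervals (kerF_int h0 t 0 s hs c1)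
    (kerF_int h0 t s t hst c2)]
  rw [sub_self, zero_rpow h0.ne', sub_zero] at l2
  have l3 := add_le_add l1 l2
  have := mul_le_mul_of_nonneg_left l3 (by positivity : 0 ≤ 1 / Real.Gamma γ)
  have e : A / Real.Gamma (1 + γ) * u s ^ p * (t - s) ^ γ =
    1 / Real.Gamma γ * (0 * (((t - 0) ^ γ - (t - s) ^ γ) / γ) + A * u s ^ p * ((t - s) ^ γ / γ)) := by
    rw [hG1]; field_simp; ring
  rw [e]; linarith

lemma SolOn.gineq {γ p A u₀ : ℝ} {u : ℝ → ℝ} {S : ℝ} (h : SolOn γ p A u₀ u S)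
    (h0 : 0 < γ) (h1 : γ < 1) (hp : 1 < p) (hA : 0 < A) (hu : 0 < u₀) {t : ℝ} (ht : 0 ≤ t)
    (htS : t ≤ S) :
    u t ^ (1 - p) ≤ u₀ ^ (1 - p) - (p - 1) * (A / Real.Gamma (1 + γ)) * t ^ γ := by
  have hG := Gamma_pos_of_pos h0
  have hG1 : Real.Gamma (1 + γ) = γ * Real.Gamma γ := by
    rw [add_comm, Real.Gamma_add_one h0.ne']
  set z : ℝ → ℝ := fun τ => u₀ + (1 / Real.Gamma γ) *
    ∫ s in (0:ℝ)..τ, s ^ (γ - 1) * (A * u s ^ p) with hz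
  have hmono := h.mono h0 hp hA
  have hFm : MonotoneOn (fun s => A * u s ^ p) (Icc 0 S) := by
    intro a ha b hb hab
    have := hmono ha hb hab
    have := (h.pos a ha)
    dsimp only
    gcongr
  have hint : ∀ τ ∈ Icc 0 S, IntervalIntegrable (fun s => s ^ (γ - 1) * (A * u s ^ p)) volume 0 τ := by
    intro τ hτ
    apply (intervalIntegral.intervalIntegrable_rpow' (by linarith)).mul_continuousOn
    rw [uIcc_of_le hτ.1]
    exact h.contF.mono (Icc_subset_Icc le_rfl hτ.2)
  have hzu : ∀ τ ∈ Icc 0 S, z τ ≤ u τ := by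
    intro τ hτ
    rw [h.eq τ hτ, hz]
    have := cheb h0 h1 hτ.1 (h.contF.mono (Icc_subset_Icc le_rfl hτ.2))
      (hFm.mono (Icc_subset_Icc le_rfl hτ.2))
    dsimp only
    gcongr
  have hz0 : ∀ τ ∈ Icc 0 S, 0 < z τ := by
    intro τ hτ
    have : 0 ≤ ∫ s in (0:ℝ)..τ, s ^ (γ - 1) * (A * u s ^ p) := by
      apply intervalIntegral.integral_nonneg hτ.1
      intro s hs
      have := h.pos s ⟨hs.1, hs.2.trans hτ.2⟩
      have := hs.1
      positivity
    simp only [hz]; positivity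
  have hzc : ContinuousOn z (Icc 0 S) := by
    have hS : 0 ≤ S := ht.trans htS
    have := intervalIntegral.continuousOn_primitive_interval' (hint S ⟨hS, le_rfl⟩)
      (left_mem_uIcc)
    rw [uIcc_of_le hS] at this
    exact continuousOn_const.add (continuousOn_const.mul this)
  have hzd : ∀ τ ∈ Ioo 0 S, HasDerivAt z ((1 / Real.Gamma γ) * (τ ^ (γ - 1) * (A * u τ ^ p))) τ := by
    intro τ hτ
    have hcc : ContinuousOn (fun s => s ^ (γ - 1) * (A * u s ^ p)) (Ioo 0 S) := by
      apply ContinuousOn.mul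
      · exact continuousOn_id.rpow_const (fun x hx => Or.inl hx.1.ne')
      · exact h.contF.mono Ioo_subset_Icc_self
    have := intervalIntegral.integral_hasDerivAt_right (hint τ ⟨hτ.1.le, hτ.2.le⟩)
      (hcc.stronglyMeasurableAtFilter isOpen_Ioo τ hτ)
      (hcc.continuousAt (isOpen_Ioo.mem_nhds hτ))
    exact (this.const_mul _).const_add _
  have hanti : AntitoneOn (fun τ => z τ ^ (1 - p) + (p - 1) * (A / Real.Gamma (1 + γ)) * τ ^ γ)
      (Icc 0 S) := by
    have hd : ∀ τ ∈ Ioo 0 S, HasDerivAt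
        (fun τ => z τ ^ (1 - p) + (p - 1) * (A / Real.Gamma (1 + γ)) * τ ^ γ)
        ((1 / Real.Gamma γ) * (τ ^ (γ - 1) * (A * u τ ^ p)) * (1 - p) * z τ ^ (1 - p - 1)
          + (p - 1) * (A / Real.Gamma (1 + γ)) * (γ * τ ^ (γ - 1))) τ := by
      intro τ hτ
      have a := (hzd τ hτ).rpow_const (p := 1 - p) (Or.inl (hz0 τ ⟨hτ.1.le, hτ.2.le⟩).ne')
      have b := (Real.hasDerivAt_rpow_const (x := τ) (p := γ) (Or.inl hτ.1.ne')).const_mul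
        ((p - 1) * (A / Real.Gamma (1 + γ)))
      exact a.add b
    apply antitoneOn_of_deriv_nonpos (convex_Icc 0 S)
    · apply ContinuousOn.add
      · exact hzc.rpow_const (fun x hx => Or.inl (hz0 x hx).ne')
      · exact continuousOn_const.mul (continuousOn_id.rpow_const (fun x _ => Or.inr h0.le))
    · rw [interior_Icc]
      exact fun τ hτ => (hd τ hτ).differentiableAt.differentiableWithinAt
    · rw [interior_Icc]
      intro τ hτ
      rw [(hd τ hτ).deriv]
      have m : τ ∈ Icc 0 S := ⟨hτ.1.le, hτ.2.le⟩
      have zp := hz0 τ m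
      have hge : 1 ≤ u τ ^ p * z τ ^ (1 - p - 1) := by
        rw [show 1 - p - 1 = -p by ring, rpow_neg zp.le, ← div_eq_mul_inv, one_le_div (by positivity)]
        have := hzu τ m
        gcongr
      have e : (1 / Real.Gamma γ) * (τ ^ (γ - 1) * (A * u τ ^ p)) * (1 - p) * z τ ^ (1 - p - 1)
          + (p - 1) * (A / Real.Gamma (1 + γ)) * (γ * τ ^ (γ - 1)) =
          ((p - 1) * A / Real.Gamma γ * τ ^ (γ - 1)) * (1 - u τ ^ p * z τ ^ (1 - p - 1)) := by
        rw [hG1]; field_simp; ring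
      rw [e]
      apply mul_nonpos_of_nonneg_of_nonpos
      · have := hτ.1
        have : 0 < p - 1 := by linarith
        positivity
      · linarith
  have hS : 0 ≤ S := ht.trans htS
  have := hanti ⟨le_rfl, hS⟩ ⟨ht, htS⟩ ht
  simp only [zero_rpow h0.ne'] at this
  have hz00 : z 0 = u₀ := by simp [hz]
  rw [hz00] at this
  have := rpow_le_rpow_of_nonpos (hz0 t ⟨ht, htS⟩) (hzu t ⟨ht, htS⟩) (by linarith : 1 - p ≤ 0)
  linarith

/-- the time scale -/
lemma scale_pow {γ p A u₀ : ℝ} (h0 : 0 < γ) (hA : 0 < A) (hu : 0 < u₀) :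
    ((Real.Gamma (1 + γ) / (A * u₀ ^ (p - 1))) ^ (1 / γ)) ^ γ =
      Real.Gamma (1 + γ) / (A * u₀ ^ (p - 1)) := by
  have := Gamma_pos_of_pos (by linarith : 0 < 1 + γ)
  rw [← rpow_mul (by positivity), one_div, inv_mul_cancel₀ h0.ne', rpow_one]

lemma geo_eq {r p : ℝ} (hr : 1 < r) (hp : 1 < p) (m : ℕ) :
    (r ^ (-(p - 1))) ^ (m + 1) / (1 - r ^ (-(p - 1))) =
      1 / (r ^ (((m : ℝ) + 1) * (p - 1)) - r ^ ((m : ℝ) * (p - 1))) := by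
  have r0 : 0 < r := by linarith
  have hq : r ^ (-(p - 1)) < 1 := rpow_lt_one_of_one_lt_of_neg hr (by linarith)
  have hQ : 1 < r ^ (p - 1) := one_lt_rpow hr (by linarith)
  rw [show ((m : ℝ) + 1) * (p - 1) = (p - 1) * ((m + 1 : ℕ) : ℝ) by push_cast; ring,
    mul_comm (m : ℝ), rpow_mul r0.le, rpow_mul r0.le, rpow_natCast, rpow_natCast, rpow_neg r0.le]
  set Q := r ^ (p - 1)
  have hQ0 : 0 < Q := by linarith
  have : Q ^ (m + 1) - Q ^ m = Q ^ m * (Q - 1) := by ring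
  rw [this]
  have h1 : Q - 1 ≠ 0 := by linarith
  have h2 : 1 - Q⁻¹ = (Q - 1) / Q := by field_simp
  rw [h2, inv_pow]
  field_simp
  try ring

lemma upper_real {γ p A u₀ : ℝ} {u : ℝ → ℝ} {S : ℝ} (h : SolOn γ p A u₀ u S)
    (h0 : 0 < γ) (h1 : γ < 1) (hp : 1 < p) (hA : 0 < A) (hu : 0 < u₀) {r : ℝ} (hr : 1 < r)
    (m : ℕ) :
    S < (Real.Gamma (1 + γ) / (A * u₀ ^ (p - 1))) ^ (1 / γ) *
      (r ^ p / (r ^ (((m : ℝ) + 1) * (p - 1)) - r ^ ((m : ℝ) * (p - 1)))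
            + ((1 - r ^ ((m : ℝ) * γ * (1 - p))) / (p - 1)) ^ (1 / γ)) := by
  by_contra hcon
  rw [not_lt] at hcon
  have hG := Gamma_pos_of_pos (by linarith : 0 < 1 + γ)
  have hC := scale_pow (p := p) h0 hA hu
  set C := (Real.Gamma (1 + γ) / (A * u₀ ^ (p - 1))) ^ (1 / γ) with hCdef
  have hC0 : 0 < C := by positivity
  have r0 : 0 < r := by linarith
  have hgeo := geo_eq hr hp m
  set q := r ^ (-(p - 1)) with hqdef
  have hq : q < 1 := rpow_lt_one_of_one_lt_of_neg hr (by linarith)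
  have hq0 : 0 < q := by positivity
  set X := (1 - r ^ ((m : ℝ) * γ * (1 - p))) / (p - 1) with hX
  have hp1 : 0 < p - 1 := by linarith
  have hXe : (p - 1) * X = 1 - r ^ ((m : ℝ) * γ * (1 - p)) := by rw [hX]; field_simp
  have hX0 : 0 ≤ X := by
    apply div_nonneg _ hp1.le
    have : r ^ ((m : ℝ) * γ * (1 - p)) ≤ 1 := by
      apply rpow_le_one_of_one_le_of_nonpos hr.le
      have : 0 ≤ (m : ℝ) * γ := by positivity
      nlinarith
    linarith
  rw [mul_add, show r ^ p / (r ^ (((m : ℝ) + 1) * (p - 1)) - r ^ ((m : ℝ) * (p - 1))) =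
    r ^ p * (1 / (r ^ (((m : ℝ) + 1) * (p - 1)) - r ^ ((m : ℝ) * (p - 1)))) by ring, ← hgeo] at hcon
  set τ : ℕ → ℝ := fun j => C * X ^ (1 / γ) + C * r ^ p * ∑ i ∈ Finset.range j, q ^ (m + 1 + i)
    with hτ
  have hτ0 : ∀ j, 0 ≤ τ j := fun j => by
    have : 0 ≤ ∑ i ∈ Finset.range j, q ^ (m + 1 + i) := Finset.sum_nonneg fun i _ => by positivity
    simp only [hτ]; positivity
  have hτS : ∀ j, τ j ≤ S := fun j => by
    have e : ∑ i ∈ Finset.range j, q ^ (m + 1 + i) ≤ q ^ (m + 1) / (1 - q) := by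
      simp_rw [pow_add q (m + 1)]
      rw [← Finset.mul_sum, div_eq_mul_inv]
      have := (summable_geometric_of_lt_one hq0.le hq).sum_le_tsum (Finset.range j)
        (fun i _ => by positivity)
      rw [tsum_geometric_of_lt_one hq0.le hq] at this
      gcongr
    have : C * r ^ p * ∑ i ∈ Finset.range j, q ^ (m + 1 + i) ≤ C * r ^ p * (q ^ (m + 1) / (1 - q)) := by
      gcongr
    simp only [hτ]; linarith
  have hstep : ∀ j : ℕ, τ (j + 1) - τ j = C * r ^ p * q ^ (m + 1 + j) := fun j => by
    simp only [hτ]; rw [Finset.sum_range_succ]; ring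
  have claim : ∀ j : ℕ, u₀ * r ^ (((m : ℝ) + j) * γ) ≤ u (τ j) := by
    intro j
    induction j with
    | zero =>
      have g := h.gineq h0 h1 hp hA hu (hτ0 0) (hτS 0)
      have e0 : τ 0 ^ γ = Real.Gamma (1 + γ) / (A * u₀ ^ (p - 1)) * X := by
        simp only [hτ, Finset.range_zero, Finset.sum_empty, mul_zero, add_zero]
        rw [mul_rpow hC0.le (by positivity), hC, ← rpow_mul hX0, one_div,
          inv_mul_cancel₀ h0.ne', rpow_one]
      have e1 : u₀ ^ (1 - p) - (p - 1) * (A / Real.Gamma (1 + γ)) * τ 0 ^ γ =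
          (u₀ * r ^ (((m : ℝ) + (0 : ℕ)) * γ)) ^ (1 - p) := by
        rw [mul_rpow hu.le (by positivity), ← rpow_mul r0.le, e0,
          show 1 - p = -(p - 1) by ring, rpow_neg hu.le]
        have : (((m : ℝ) + (0 : ℕ)) * γ * -(p - 1)) = (m : ℝ) * γ * (1 - p) := by
          push_cast; ring
        rw [this, show r ^ ((m : ℝ) * γ * (1 - p)) = 1 - (p - 1) * X by linarith]
        field_simp
      rw [e1] at g
      exact (rpow_le_rpow_iff_of_neg (h.pos _ ⟨hτ0 0, hτS 0⟩) (by positivity)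
        (by linarith)).1 g
    | succ j ih =>
      have hd := hstep j
      have s := h.step h0 hp hA hu (hτ0 j) (by
        have : 0 ≤ C * r ^ p * q ^ (m + 1 + j) := by positivity
        linarith) (hτS (j + 1))
      refine le_trans ?_ s
      rw [hd]
      have : A / Real.Gamma (1 + γ) * (u₀ * r ^ (((m : ℝ) + j) * γ)) ^ p * (C * r ^ p * q ^ (m + 1 + j)) ^ γ
        ≤ A / Real.Gamma (1 + γ) * u (τ j) ^ p * (C * r ^ p * q ^ (m + 1 + j)) ^ γ := by
        gcongr
      refine le_trans (le_of_eq ?_) this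
      rw [mul_rpow hu.le (by positivity), mul_rpow (by positivity) (by positivity),
        mul_rpow hC0.le (by positivity), hC, hqdef, ← rpow_natCast, ← rpow_mul r0.le,
        ← rpow_mul r0.le, ← rpow_mul r0.le, ← rpow_mul r0.le]
      have e2 : u₀ ^ p = u₀ ^ (p - 1) * u₀ := by
        rw [← rpow_add_one hu.ne']; congr 1; ring
      have e3 : r ^ (((m : ℝ) + (j + 1 : ℕ)) * γ) = r ^ (((m : ℝ) + j) * γ * p) *
          r ^ (p * γ) * r ^ (-(p - 1) * ((m + 1 + j : ℕ) : ℝ) * γ) := by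
        rw [← rpow_add r0, ← rpow_add r0]; congr 1; push_cast; ring
      rw [e2, e3]
      field_simp
  have hS : 0 ≤ S := (hτ0 0).trans (hτS 0)
  have hbd : ∀ j : ℕ, u₀ * (r ^ γ) ^ j ≤ u S := by
    intro j
    have := (claim j).trans (h.mono h0 hp hA ⟨hτ0 j, hτS j⟩ ⟨hS, le_rfl⟩ (hτS j))
    refine le_trans ?_ this
    rw [← rpow_natCast, ← rpow_mul r0.le]
    have : γ * (j : ℝ) ≤ ((m : ℝ) + j) * γ := by
      have : 0 ≤ (m : ℝ) * γ := by positivity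
      linarith
    have := rpow_le_rpow_of_exponent_le hr.le this
    gcongr
  obtain ⟨j, hj⟩ := pow_unbounded_of_one_lt (u S / u₀) (one_lt_rpow hr h0)
  have := hbd j
  rw [div_lt_iff₀ hu] at hj
  linarith

lemma kerF_holder {γ : ℝ} (h0 : 0 < γ) (h1 : γ < 1) {F : ℝ → ℝ} {t t' M : ℝ} (ht : 0 ≤ t)
    (htt : t ≤ t') (hF : ContinuousOn F (Icc 0 t')) (hM : ∀ s ∈ Icc 0 t', F s ≤ M)
    (hF0 : ∀ s ∈ Icc 0 t', 0 ≤ F s) :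
    |(∫ s in (0:ℝ)..t', (t' - s) ^ (γ - 1) * F s) - ∫ s in (0:ℝ)..t, (t - s) ^ (γ - 1) * F s|
      ≤ M / γ * (t' - t) ^ γ := by
  have hM0 : 0 ≤ M := (hF0 0 ⟨le_rfl, ht.trans htt⟩).trans (hM 0 ⟨le_rfl, ht.trans htt⟩)
  have c1 : ContinuousOn F (Icc 0 t) := hF.mono (Icc_subset_Icc le_rfl htt)
  have c2 : ContinuousOn F (Icc t t') := hF.mono (Icc_subset_Icc ht le_rfl)
  rw [← intervalIntegral.integral_add_adjacent_intervals (kerF_int h0 t' 0 t ht c1)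
    (kerF_int h0 t' t t' htt c2)]
  have a1 := le_kerF (M := 0) h0 htt le_rfl c2 (fun s hs => hF0 s ⟨by linarith [hs.1], hs.2⟩)
  have a2 := kerF_le (M := M) h0 htt le_rfl c2 (fun s hs => hM s ⟨by linarith [hs.1], hs.2⟩)
  rw [sub_self, zero_rpow h0.ne', sub_zero] at a1 a2
  have b1 : ∫ s in (0:ℝ)..t, (t' - s) ^ (γ - 1) * F s ≤ ∫ s in (0:ℝ)..t, (t - s) ^ (γ - 1) * F s := by
    apply intervalIntegral.integral_mono_on_of_le_Ioo ht (kerF_int h0 t' 0 t ht c1)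
      (kerF_int h0 t 0 t ht c1)
    intro s hs
    exact mul_le_mul_of_nonneg_right (rpow_le_rpow_of_nonpos (by linarith [hs.2]) (by linarith)
      (by linarith)) (hF0 s ⟨hs.1.le, by linarith [hs.2]⟩)
  have b2 : ∫ s in (0:ℝ)..t, ((t - s) ^ (γ - 1) * F s - (t' - s) ^ (γ - 1) * F s) ≤
      ∫ s in (0:ℝ)..t, M * ((t - s) ^ (γ - 1) - (t' - s) ^ (γ - 1)) := by
    apply intervalIntegral.integral_mono_on_of_le_Ioo ht
      ((kerF_int h0 t 0 t ht c1).sub (kerF_int h0 t' 0 t ht c1))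
      (((ker_int h0 t 0 t).sub (ker_int h0 t' 0 t)).const_mul M)
    intro s hs
    have k := rpow_le_rpow_of_nonpos (by linarith [hs.2] : 0 < t - s) (by linarith : t - s ≤ t' - s)
      (by linarith : γ - 1 ≤ 0)
    have := hM s ⟨hs.1.le, by linarith [hs.2]⟩
    nlinarith [mul_nonneg (sub_nonneg.2 k) (sub_nonneg.2 this)]
  rw [intervalIntegral.integral_sub (kerF_int h0 t 0 t ht c1) (kerF_int h0 t' 0 t ht c1),
    intervalIntegral.integral_const_mul, intervalIntegral.integral_sub (ker_int h0 t 0 t)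
    (ker_int h0 t' 0 t), ker_val h0, ker_val h0, sub_self, zero_rpow h0.ne', sub_zero, sub_zero,
    sub_zero] at b2
  have b3 : t ^ γ ≤ t' ^ γ := rpow_le_rpow ht htt h0.le
  have b4 : M * (t ^ γ / γ - (t' ^ γ - (t' - t) ^ γ) / γ) ≤ M / γ * (t' - t) ^ γ := by
    have : M * (t ^ γ / γ - (t' ^ γ - (t' - t) ^ γ) / γ) =
      M / γ * (t ^ γ - t' ^ γ) + M / γ * (t' - t) ^ γ := by field_simp; ring
    rw [this]
    have : M / γ * (t ^ γ - t' ^ γ) ≤ 0 :=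
      mul_nonpos_of_nonneg_of_nonpos (by positivity) (by linarith)
    linarith
  have a3 : M * ((t' - t) ^ γ / γ) = M / γ * (t' - t) ^ γ := by ring
  rw [a3] at a2
  rw [abs_le]
  constructor <;> linarith

lemma cont_of_holder {γ K S : ℝ} (h0 : 0 < γ) {g : ℝ → ℝ}
    (h : ∀ t t', 0 ≤ t → t ≤ t' → t' ≤ S → |g t' - g t| ≤ K * (t' - t) ^ γ) :
    ContinuousOn g (Icc 0 S) := by
  intro x hx
  have h2 : ∀ y ∈ Icc 0 S, |g y - g x| ≤ K * |y - x| ^ γ := by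
    intro y hy
    rcases le_total x y with hh | hh
    · rw [abs_of_nonneg (sub_nonneg.2 hh)]; exact h x y hx.1 hh hy.2
    · rw [abs_sub_comm, abs_sub_comm y x, abs_of_nonneg (sub_nonneg.2 hh)]; exact h y x hy.1 hh hx.2
  have lim : Tendsto (fun y => K * |y - x| ^ γ) (𝓝[Icc 0 S] x) (𝓝 0) := by
    have : Continuous fun y : ℝ => K * |y - x| ^ γ := by
      apply continuous_const.mul
      exact (by fun_prop : Continuous fun y : ℝ => |y - x|).rpow_const (fun _ => Or.inr h0.le)
    have := this.continuousWithinAt (s := Icc 0 S) (x := x)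
    simpa [ContinuousWithinAt, zero_rpow h0.ne'] using this
  rw [ContinuousWithinAt, tendsto_iff_dist_tendsto_zero]
  apply squeeze_zero' (Eventually.of_forall fun y => dist_nonneg) _ lim
  filter_upwards [self_mem_nhdsWithin] with y hy
  rw [Real.dist_eq]; exact h2 y hy

/-- Picard operator -/
noncomputable def picOp (γ p A u₀ : ℝ) (v : ℝ → ℝ) (t : ℝ) : ℝ :=
  u₀ + (1 / Real.Gamma γ) * ∫ s in (0:ℝ)..t, (t - s) ^ (γ - 1) * (A * v s ^ p)

lemma exists_sol {γ p A u₀ S M : ℝ} (h0 : 0 < γ) (h1 : γ < 1) (hp : 1 < p) (hA : 0 < A)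
    (hu : 0 < u₀) (Q : (ℝ → ℝ) → Prop) (hQ0 : Q fun _ => u₀)
    (hQM : ∀ v, Q v → ∀ t ∈ Icc 0 S, v t ≤ M)
    (hQ : ∀ v, ContinuousOn v (Icc 0 S) → (∀ t ∈ Icc 0 S, u₀ ≤ v t) → Q v →
      Q (picOp γ p A u₀ v)) :
    ∃ u, SolOn γ p A u₀ u S := by
  have hG := Gamma_pos_of_pos h0
  set w : ℕ → ℝ → ℝ := fun k => (picOp γ p A u₀)^[k] (fun _ => u₀) with hw
  have hws : ∀ k, w (k + 1) = picOp γ p A u₀ (w k) := fun k => by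
    simp only [hw, Function.iterate_succ_apply']
  have contF : ∀ v : ℝ → ℝ, ContinuousOn v (Icc 0 S) → (∀ t ∈ Icc 0 S, u₀ ≤ v t) →
      ContinuousOn (fun s => A * v s ^ p) (Icc 0 S) := fun v hv hv2 =>
    continuousOn_const.mul (hv.rpow_const fun t ht => Or.inl (hu.trans_le (hv2 t ht)).ne')
  have hol : ∀ v : ℝ → ℝ, ContinuousOn v (Icc 0 S) → (∀ t ∈ Icc 0 S, u₀ ≤ v t) → Q v →
      ∀ t t', 0 ≤ t → t ≤ t' → t' ≤ S → |picOp γ p A u₀ v t' - picOp γ p A u₀ v t| ≤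
        (1 / Real.Gamma γ * (A * M ^ p / γ)) * (t' - t) ^ γ := by
    intro v hv hv2 hvQ t t' ht htt hts
    have := kerF_holder (M := A * M ^ p) h0 h1 ht htt
      ((contF v hv hv2).mono (Icc_subset_Icc le_rfl hts))
      (fun s hs => by
        have a := hQM v hvQ s ⟨hs.1, hs.2.trans hts⟩
        have b := hv2 s ⟨hs.1, hs.2.trans hts⟩
        have : 0 ≤ v s := by linarith
        gcongr)
      (fun s hs => by
        have b := hv2 s ⟨hs.1, hs.2.trans hts⟩
        have : 0 ≤ v s := by linarith
        positivity)
    unfold picOp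
    rw [add_sub_add_left_eq_sub, ← mul_sub, abs_mul, abs_of_pos (by positivity), mul_assoc]
    gcongr
  have inv : ∀ k, ContinuousOn (w k) (Icc 0 S) ∧ (∀ t ∈ Icc 0 S, u₀ ≤ w k t) ∧ Q (w k) := by
    intro k
    induction k with
    | zero => exact ⟨continuousOn_const, fun t _ => le_rfl, hQ0⟩
    | succ k ih =>
      obtain ⟨ih1, ih2, ih3⟩ := ih
      rw [hws]
      refine ⟨cont_of_holder h0 (hol _ ih1 ih2 ih3), fun t ht => ?_, hQ _ ih1 ih2 ih3⟩
      unfold picOp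
      have : 0 ≤ ∫ s in (0:ℝ)..t, (t - s) ^ (γ - 1) * (A * w k s ^ p) := by
        apply intervalIntegral.integral_nonneg ht.1
        intro s hs
        have a := ih2 s ⟨hs.1, hs.2.trans ht.2⟩
        have b : 0 ≤ w k s := by linarith
        have : 0 ≤ t - s := by linarith [hs.2]
        positivity
      have : 0 ≤ 1 / Real.Gamma γ * ∫ s in (0:ℝ)..t, (t - s) ^ (γ - 1) * (A * w k s ^ p) := by
        positivity
      linarith
  have mono1 : ∀ k, ∀ t ∈ Icc 0 S, w k t ≤ w (k + 1) t := by
    intro k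
    induction k with
    | zero => exact fun t ht => (inv 1).2.1 t ht
    | succ k ih =>
      intro t ht
      rw [hws, hws (k + 1)]
      unfold picOp
      have : ∫ s in (0:ℝ)..t, (t - s) ^ (γ - 1) * (A * w k s ^ p) ≤
          ∫ s in (0:ℝ)..t, (t - s) ^ (γ - 1) * (A * w (k + 1) s ^ p) := by
        apply intervalIntegral.integral_mono_on ht.1
        · exact kerF_int h0 t 0 t ht.1
            ((contF _ (inv k).1 (inv k).2.1).mono (Icc_subset_Icc le_rfl ht.2))
        · exact kerF_int h0 t 0 t ht.1
            ((contF _ (inv (k + 1)).1 (inv (k + 1)).2.1).mono (Icc_subset_Icc le_rfl ht.2))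
        · intro s hs
          have m : s ∈ Icc 0 S := ⟨hs.1, hs.2.trans ht.2⟩
          have a := (inv k).2.1 s m
          have b := ih s m
          have c : 0 ≤ w k s := by linarith
          have : 0 ≤ t - s := by linarith [hs.2]
          gcongr
      gcongr
  have mono : ∀ t ∈ Icc 0 S, Monotone fun k => w k t := fun t ht =>
    monotone_nat_of_le_succ fun k => mono1 k t ht
  have bdd : ∀ t ∈ Icc 0 S, BddAbove (range fun k => w k t) := fun t ht =>
    ⟨M, by rintro _ ⟨k, rfl⟩; exact hQM _ (inv k).2.2 t ht⟩
  set u : ℝ → ℝ := fun t => ⨆ k, w k t with hudef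
  have lim : ∀ t ∈ Icc 0 S, Tendsto (fun k => w k t) atTop (𝓝 (u t)) := fun t ht =>
    tendsto_atTop_ciSup (mono t ht) (bdd t ht)
  have hu0 : ∀ t ∈ Icc 0 S, u₀ ≤ u t := fun t ht =>
    ge_of_tendsto' (lim t ht) fun k => (inv k).2.1 t ht
  refine ⟨u, ?_, fun t ht => hu.trans_le (hu0 t ht), ?_⟩
  · apply cont_of_holder (γ := γ) (K := 1 / Real.Gamma γ * (A * M ^ p / γ)) h0
    intro t t' ht htt hts
    have l1 := (tendsto_add_atTop_iff_nat 1).2 (lim t ⟨ht, htt.trans hts⟩)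
    have l2 := (tendsto_add_atTop_iff_nat 1).2 (lim t' ⟨ht.trans htt, hts⟩)
    refine le_of_tendsto' (l2.sub l1).abs fun k => ?_
    rw [hws]
    exact hol _ (inv k).1 (inv k).2.1 (inv k).2.2 t t' ht htt hts
  · intro t ht
    have l1 := (tendsto_add_atTop_iff_nat 1).2 (lim t ht)
    refine tendsto_nhds_unique l1 ?_
    simp_rw [hws]
    unfold picOp
    refine tendsto_const_nhds.add (tendsto_const_nhds.mul ?_)
    apply intervalIntegral.tendsto_integral_filter_of_dominated_convergence
      (fun s => (t - s) ^ (γ - 1) * (A * M ^ p))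
    · refine Eventually.of_forall fun k => ?_
      exact (kerF_int h0 t 0 t ht.1
        ((contF _ (inv k).1 (inv k).2.1).mono (Icc_subset_Icc le_rfl ht.2))).def'.aestronglyMeasurable
    · refine Eventually.of_forall fun k => Eventually.of_forall fun s hs => ?_
      rw [uIoc_of_le ht.1] at hs
      have m : s ∈ Icc 0 S := ⟨hs.1.le, hs.2.trans ht.2⟩
      have a := (inv k).2.1 s m
      have c : 0 ≤ w k s := by linarith
      have b := hQM _ (inv k).2.2 s m
      have : 0 ≤ t - s := by linarith [hs.2]
      rw [Real.norm_of_nonneg (by positivity)]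
      gcongr
    · exact (ker_int h0 t 0 t).mul_const _
    · refine Eventually.of_forall fun s hs => ?_
      rw [uIoc_of_le ht.1] at hs
      have m : s ∈ Icc 0 S := ⟨hs.1.le, hs.2.trans ht.2⟩
      refine tendsto_const_nhds.mul (tendsto_const_nhds.mul ?_)
      exact (lim s m).rpow_const (Or.inl (hu.trans_le (hu0 s m)).ne')

lemma step_int {γ : ℝ} (h0 : 0 < γ) (h1 : γ < 1) {F : ℝ → ℝ} {t : ℝ} (ht : 0 ≤ t)
    (hF : ContinuousOn F (Icc 0 t)) {T a : ℕ → ℝ} (hT0 : T 0 = 0) (hT : Monotone T)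
    (ha : ∀ k, 0 ≤ a k) (n : ℕ) (hle : ∀ k < n, ∀ s ∈ Icc 0 t, s ≤ T (k + 1) → F s ≤ a k) :
    ∫ s in (0:ℝ)..(min t (T n)), (t - s) ^ (γ - 1) * F s ≤
      (∑ k ∈ Finset.range n, a k * (T (k + 1) - T k) ^ γ) / γ := by
  have hTn : ∀ n, 0 ≤ T n := fun n => hT0 ▸ hT (Nat.zero_le n)
  induction n with
  | zero => simp [hT0, ht]
  | succ n ih =>
    have ih := ih fun k hk => hle k (by omega)
    have hTs : T n ≤ T (n + 1) := hT (Nat.le_succ n)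
    have m0 : 0 ≤ min t (T n) := le_min ht (hTn n)
    have m1 : min t (T n) ≤ min t (T (n + 1)) := min_le_min le_rfl hTs
    have m2 : min t (T (n + 1)) ≤ t := min_le_left _ _
    have c1 : ContinuousOn F (Icc 0 (min t (T n))) :=
      hF.mono (Icc_subset_Icc le_rfl (min_le_left _ _))
    have c2 : ContinuousOn F (Icc (min t (T n)) (min t (T (n + 1)))) :=
      hF.mono (Icc_subset_Icc m0 m2)
    rw [← intervalIntegral.integral_add_adjacent_intervals (kerF_int h0 t _ _ m0 c1)
      (kerF_int h0 t _ _ m1 c2), Finset.sum_range_succ, add_div]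
    have k := kerF_le (M := a n) h0 (t := t) m1 m2 c2 (fun s hs =>
      hle n (by omega) s ⟨m0.trans hs.1, hs.2.trans m2⟩ (hs.2.trans (min_le_right _ _)))
    have hd : min t (T (n + 1)) - min t (T n) ≤ T (n + 1) - T n := by
      rcases le_total t (T n) with h | h
      · rw [min_eq_left h, min_eq_left (h.trans hTs)]; linarith
      · rw [min_eq_right h]; linarith [min_le_right t (T (n + 1))]
    have sub : (t - min t (T n)) ^ γ ≤
        (t - min t (T (n + 1))) ^ γ + (T (n + 1) - T n) ^ γ := by
      have := rpow_add_le_add_rpow (a := t - min t (T (n + 1))) (b := T (n + 1) - T n)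
        (by linarith) (by linarith) h0.le h1.le
      refine le_trans ?_ this
      apply rpow_le_rpow _ _ h0.le <;> linarith
    have : a n * (((t - min t (T n)) ^ γ - (t - min t (T (n + 1))) ^ γ) / γ) ≤
        a n * (T (n + 1) - T n) ^ γ / γ := by
      rw [mul_div_assoc]
      have := ha n
      gcongr
      linarith
    linarith

lemma lower_exists {γ p A u₀ : ℝ} (h0 : 0 < γ) (h1 : γ < 1) (hp : 1 < p) (hA : 0 < A)
    (hu : 0 < u₀) {r : ℝ} (hr : 1 < r) (N : ℕ) :
    ∃ u, SolOn γ p A u₀ u (∑ k ∈ Finset.range N,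
      (Real.Gamma (1 + γ) / (A * u₀ ^ (p - 1))) ^ (1 / γ) * (r ^ γ - 1) ^ (1 / γ) * r⁻¹ *
        (r ^ (-(p - 1))) ^ (k + 1)) := by
  have hG := Gamma_pos_of_pos h0
  have hG' := Gamma_pos_of_pos (by linarith : 0 < 1 + γ)
  have hG1 : Real.Gamma (1 + γ) = γ * Real.Gamma γ := by
    rw [add_comm, Real.Gamma_add_one h0.ne']
  have hC := scale_pow (p := p) h0 hA hu
  set C := (Real.Gamma (1 + γ) / (A * u₀ ^ (p - 1))) ^ (1 / γ) with hCdef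
  have hC0 : 0 < C := by positivity
  have r0 : 0 < r := by linarith
  have hrγ : 0 < r ^ γ - 1 := by linarith [one_lt_rpow hr h0]
  set δ : ℕ → ℝ := fun k => C * (r ^ γ - 1) ^ (1 / γ) * r⁻¹ * (r ^ (-(p - 1))) ^ (k + 1) with hδ
  have hδ0 : ∀ k, 0 < δ k := fun k => by simp only [hδ]; positivity
  set T : ℕ → ℝ := fun n => ∑ k ∈ Finset.range n, δ k with hTdef
  have hTs : ∀ n, T (n + 1) - T n = δ n := fun n => by
    simp only [hTdef]; rw [Finset.sum_range_succ]; ring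
  have hTm : Monotone T := monotone_nat_of_le_succ fun n => by
    have := hTs n; have := hδ0 n; linarith
  have hT0 : T 0 = 0 := by simp [hTdef]
  change ∃ u, SolOn γ p A u₀ u (T N)
  set a : ℕ → ℝ := fun k => A * (u₀ * r ^ (((k : ℝ) + 1) * γ)) ^ p with ha
  have hterm : ∀ k, a k * δ k ^ γ = Real.Gamma (1 + γ) * (u₀ * (r ^ γ - 1) * (r ^ γ) ^ k) := by
    intro k
    simp only [ha, hδ]
    rw [mul_rpow hu.le (by positivity), mul_rpow (by positivity) (by positivity),
      mul_rpow (by positivity) (by positivity), mul_rpow hC0.le (by positivity), hC,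
      ← rpow_mul hrγ.le, one_div, inv_mul_cancel₀ h0.ne', rpow_one, ← rpow_neg_one r,
      ← rpow_natCast, ← rpow_natCast, ← rpow_mul r0.le, ← rpow_mul r0.le, ← rpow_mul r0.le,
      ← rpow_mul r0.le, ← rpow_mul r0.le]
    have e2 : u₀ ^ p = u₀ ^ (p - 1) * u₀ := by
      rw [← rpow_add_one hu.ne']; congr 1; ring
    have e3 : r ^ (γ * (k : ℝ)) = r ^ (((k : ℝ) + 1) * γ * p) * r ^ (-1 * γ) *
        r ^ (-(p - 1) * ((k + 1 : ℕ) : ℝ) * γ) := by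
      rw [← rpow_add r0, ← rpow_add r0]; congr 1; push_cast; ring
    rw [e2, e3]
    field_simp
  have hsum : ∀ n, (1 / Real.Gamma γ) * ((∑ k ∈ Finset.range n, a k * δ k ^ γ) / γ) =
      u₀ * ((r ^ γ) ^ n - 1) := by
    intro n
    simp_rw [hterm]
    rw [← Finset.mul_sum, ← Finset.mul_sum, geom_sum_eq (by linarith), hG1]
    field_simp
  apply exists_sol (M := u₀ * (r ^ γ) ^ N) h0 h1 hp hA hu
    (fun v => ∀ n ≤ N, ∀ t, 0 ≤ t → t ≤ T n → v t ≤ u₀ * (r ^ γ) ^ n)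
  · intro n _ t _ _
    exact le_mul_of_one_le_right hu.le (one_le_pow₀ (by linarith))
  · exact fun v hv t ht => hv N le_rfl t ht.1 ht.2
  · intro v hv hv0 hvQ n hn t ht htn
    have htN : t ≤ T N := htn.trans (hTm hn)
    have hF : ContinuousOn (fun s => A * v s ^ p) (Icc 0 t) :=
      (continuousOn_const.mul (hv.rpow_const fun t ht =>
        Or.inl (hu.trans_le (hv0 t ht)).ne')).mono (Icc_subset_Icc le_rfl htN)
    have := step_int h0 h1 ht hF hT0 hTm (a := a)
      (fun k => by simp only [ha]; positivity) n (by
        intro k hk s hs hsT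
        have h2 := hvQ (k + 1) (by omega) s hs.1 hsT
        have h3 := hu.trans_le (hv0 s ⟨hs.1, hs.2.trans htN⟩)
        have e : (r ^ γ) ^ (k + 1) = r ^ (((k : ℝ) + 1) * γ) := by
          rw [← rpow_natCast, ← rpow_mul r0.le]; congr 1; push_cast; ring
        rw [e] at h2
        simp only [ha]
        gcongr)
    rw [min_eq_left htn] at this
    simp_rw [hTs] at this
    have := mul_le_mul_of_nonneg_left this (by positivity : 0 ≤ 1 / Real.Gamma γ)
    rw [hsum] at this
    unfold picOp
    linarith

lemma SolOn.isSol {γ p A u₀ : ℝ} {u : ℝ → ℝ} {S : ℝ} (h : SolOn γ p A u₀ u S) (hS : 0 ≤ S) :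
    IsSolUpTo γ (fun x => A * x ^ p) (Set.Ioi 0) u₀ u (ENNReal.ofReal S) := by
  have m : ∀ t : ℝ, 0 ≤ t → ENNReal.ofReal t < ENNReal.ofReal S → t ∈ Icc 0 S := fun t ht h =>
    ⟨ht, ((ENNReal.ofReal_lt_ofReal_iff_of_nonneg ht).1 h).le⟩
  refine ⟨?_, h.cont.mono fun t ht => m t ht.1 ht.2, fun t ht h' => h.pos t (m t ht h'),
    fun t ht h' => h.eq t (m t ht h')⟩
  have := h.eq 0 ⟨le_rfl, hS⟩
  simpa using this

lemma IsSolUpTo.solOn {γ p A u₀ : ℝ} {u : ℝ → ℝ} {T : ℝ≥0∞} {S : ℝ}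
    (h : IsSolUpTo γ (fun x => A * x ^ p) (Set.Ioi 0) u₀ u T) (hS : ENNReal.ofReal S < T) :
    SolOn γ p A u₀ u S := by
  have m : ∀ t ∈ Icc 0 S, ENNReal.ofReal t < T := fun t ht =>
    (ENNReal.ofReal_le_ofReal ht.2).trans_lt hS
  exact ⟨h.2.1.mono fun t ht => ⟨ht.1, m t ht⟩, fun t ht => h.2.2.1 t ht.1 (m t ht),
    fun t ht => h.2.2.2 t ht.1 (m t ht)⟩

/-- sup/inf bounds on the blow-up time of `D_c^γ u = A u^p`, `p > 1`. -/
theorem stmt11 (γ p A u₀ : ℝ)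
    (hγ : γ ∈ Set.Ioo (0:ℝ) 1) (hp : 1 < p) (hA : 0 < A) (hu₀ : 0 < u₀)
    (hfin : maxTime γ (fun x => A * x ^ p) (Set.Ioi 0) u₀ < ⊤) :
    ENNReal.ofReal ((Real.Gamma (1 + γ) / (A * u₀ ^ (p - 1))) ^ (1 / γ) *
        ⨆ r : {r : ℝ // 1 < r},
          ((r : ℝ) ^ γ - 1) ^ (1 / γ) / ((r : ℝ) * ((r : ℝ) ^ (p - 1) - 1)))
      ≤ maxTime γ (fun x => A * x ^ p) (Set.Ioi 0) u₀ ∧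
    maxTime γ (fun x => A * x ^ p) (Set.Ioi 0) u₀ ≤
      ENNReal.ofReal ((Real.Gamma (1 + γ) / (A * u₀ ^ (p - 1))) ^ (1 / γ) *
        ⨅ (r : {r : ℝ // 1 < r}) (m : ℕ+),
          ((r : ℝ) ^ p /
              ((r : ℝ) ^ (((m : ℝ) + 1) * (p - 1)) - (r : ℝ) ^ ((m : ℝ) * (p - 1)))
            + ((1 - (r : ℝ) ^ ((m : ℝ) * γ * (1 - p))) / (p - 1)) ^ (1 / γ))) := by
  obtain ⟨h0, h1⟩ := hγ
  have hG := Gamma_pos_of_pos (by linarith : 0 < 1 + γ)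
  set Tb := maxTime γ (fun x => A * x ^ p) (Set.Ioi 0) u₀ with hTb
  have hC0 : 0 < (Real.Gamma (1 + γ) / (A * u₀ ^ (p - 1))) ^ (1 / γ) := by positivity
  haveI : Nonempty {r : ℝ // 1 < r} := ⟨⟨2, by norm_num⟩⟩
  constructor
  · rw [ENNReal.ofReal_le_iff_le_toReal hfin.ne, ← le_div_iff₀' hC0]
    apply ciSup_le
    rintro ⟨r, hr⟩
    rw [le_div_iff₀' hC0]
    dsimp only
    have r0 : 0 < r := by linarith
    have hq : r ^ (-(p - 1)) < 1 := rpow_lt_one_of_one_lt_of_neg hr (by linarith)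
    have hq0 : 0 < r ^ (-(p - 1)) := by positivity
    have hrγ : 0 < r ^ γ - 1 := by linarith [one_lt_rpow hr h0]
    have hN : ∀ N : ℕ, ∑ k ∈ Finset.range N,
        (Real.Gamma (1 + γ) / (A * u₀ ^ (p - 1))) ^ (1 / γ) * (r ^ γ - 1) ^ (1 / γ) * r⁻¹ *
        (r ^ (-(p - 1))) ^ (k + 1) ≤ Tb.toReal := by
      intro N
      obtain ⟨u, hu⟩ := lower_exists h0 h1 hp hA hu₀ hr N
      rw [← ENNReal.ofReal_le_iff_le_toReal hfin.ne]
      exact le_sSup ⟨u, hu.isSol (Finset.sum_nonneg fun k _ => by positivity)⟩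
    have hs := ((hasSum_geometric_of_lt_one hq0.le hq).mul_left
      ((Real.Gamma (1 + γ) / (A * u₀ ^ (p - 1))) ^ (1 / γ) * (r ^ γ - 1) ^ (1 / γ) * r⁻¹ *
        r ^ (-(p - 1)))).tendsto_sum_nat
    refine le_trans (le_of_eq ?_) (le_of_tendsto' hs fun N => le_trans (le_of_eq ?_) (hN N))
    · have hQ : 1 < r ^ (p - 1) := one_lt_rpow hr (by linarith)
      rw [rpow_neg r0.le]
      set Q := r ^ (p - 1)
      have hQ0 : 0 < Q := by linarith
      have hQ1 : Q - 1 ≠ 0 := by linarith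
      have h2 : 1 - Q⁻¹ = (Q - 1) / Q := by field_simp
      rw [h2]
      field_simp
    · apply Finset.sum_congr rfl
      intro k _
      ring
  · have main : ∀ (r : {r : ℝ // 1 < r}) (m : ℕ+), Tb ≤
        ENNReal.ofReal ((Real.Gamma (1 + γ) / (A * u₀ ^ (p - 1))) ^ (1 / γ) *
          ((r : ℝ) ^ p /
              ((r : ℝ) ^ (((m : ℝ) + 1) * (p - 1)) - (r : ℝ) ^ ((m : ℝ) * (p - 1)))
            + ((1 - (r : ℝ) ^ ((m : ℝ) * γ * (1 - p))) / (p - 1)) ^ (1 / γ))) := by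
      rintro ⟨r, hr⟩ m
      apply sSup_le
      rintro T ⟨u, hu⟩
      by_contra hcon
      rw [not_le] at hcon
      exact lt_irrefl _ (upper_real (hu.solOn hcon) h0 h1 hp hA hu₀ hr (m : ℕ))
    have hpos : ∀ (r : {r : ℝ // 1 < r}) (m : ℕ+), 0 ≤
          ((r : ℝ) ^ p /
              ((r : ℝ) ^ (((m : ℝ) + 1) * (p - 1)) - (r : ℝ) ^ ((m : ℝ) * (p - 1)))
            + ((1 - (r : ℝ) ^ ((m : ℝ) * γ * (1 - p))) / (p - 1)) ^ (1 / γ)) := by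
      rintro ⟨r, hr⟩ m
      dsimp only
      have r0 : 0 < r := by linarith
      have hm : 0 ≤ (m : ℝ) := by positivity
      apply add_nonneg
      · apply div_nonneg (by positivity)
        rw [sub_nonneg]
        apply rpow_le_rpow_of_exponent_le hr.le
        nlinarith
      · apply rpow_nonneg
        apply div_nonneg _ (by linarith)
        rw [sub_nonneg]
        apply rpow_le_one_of_one_le_of_nonpos hr.le
        have : 0 ≤ (m : ℝ) * γ := by positivity
        nlinarith
    rw [← ENNReal.ofReal_toReal hfin.ne]
    apply ENNReal.ofReal_le_ofReal
    rw [← div_le_iff₀' hC0]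
    refine le_ciInf fun r => le_ciInf fun m => ?_
    rw [div_le_iff₀' hC0]
    exact ENNReal.toReal_le_of_le_ofReal (mul_nonneg hC0.le (hpos r m)) (main r m)
end
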